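/- arXiv:2101.11291 — 2 statements merged into one kernel-verified Lean document; each statement's English description precedes it below -/
import Mathlib

section
/- Let 𝔫 be a finite-dimensional Lie algebra over ℚ with center 𝔷. The Lie algebra ℂ ⊗_ℚ 𝔫 admits a special grading if and only if there exists a Lie algebra automorphism f of 𝔫 such that no eigenvalue of the restriction of f to 𝔷 is an algebraic integer. -/
open TensorProduct

/-- A (ℤ-)grading of a Lie algebra `𝔪` over `K`: a direct sum decomposition
`𝔪 = ⊕_{k ∈ ℤ} 𝔪ₖ` with `⁅𝔪ᵢ, 𝔪ⱼ⁆ ⊆ 𝔪ᵢ₊ⱼ`. -/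
def IsLieGrading (K 𝔪 : Type*) [CommRing K] [LieRing 𝔪] [LieAlgebra K 𝔪]
    (p : ℤ → Submodule K 𝔪) : Prop :=
  DirectSum.IsInternal p ∧
    ∀ (i j : ℤ), ∀ x ∈ p i, ∀ y ∈ p j, ⁅x, y⁆ ∈ p (i + j)

/-- A Lie algebra admits a *special* grading if it has a grading with `𝔪₀ ∩ 𝔷 = 0`,
where `𝔷` is the center. -/
def HasSpecialGrading (K 𝔪 : Type*) [CommRing K] [LieRing 𝔪] [LieAlgebra K 𝔪] : Prop :=
  ∃ p : ℤ → Submodule K 𝔪, IsLieGrading K 𝔪 p ∧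
    p 0 ⊓ (LieAlgebra.center K 𝔪).toSubmodule = ⊥

/-- A Lie algebra admits a *very special* grading if it has a grading with `𝔪₀ = 0`. -/
def HasVerySpecialGrading (K 𝔪 : Type*) [CommRing K] [LieRing 𝔪] [LieAlgebra K 𝔪] : Prop :=
  ∃ p : ℤ → Submodule K 𝔪, IsLieGrading K 𝔪 p ∧ p 0 = ⊥

/-- A Lie algebra admits a *non-negative special* grading if it has a grading with
`𝔪ₖ = 0` for `k < 0` and `𝔪₀ ∩ 𝔷 = 0`. -/
def HasNonnegSpecialGrading (K 𝔪 : Type*) [CommRing K] [LieRing 𝔪] [LieAlgebra K 𝔪] : Prop :=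
  ∃ p : ℤ → Submodule K 𝔪, IsLieGrading K 𝔪 p ∧ (∀ k < 0, p k = ⊥) ∧
    p 0 ⊓ (LieAlgebra.center K 𝔪).toSubmodule = ⊥

/-- A Lie algebra admits a *positive* grading if it has a grading with
`𝔪ₖ = 0` for `k ≤ 0`. -/
def HasPositiveGrading (K 𝔪 : Type*) [CommRing K] [LieRing 𝔪] [LieAlgebra K 𝔪] : Prop :=
  ∃ p : ℤ → Submodule K 𝔪, IsLieGrading K 𝔪 p ∧ ∀ k ≤ 0, p k = ⊥

open Polynomial Module

/-- If `F` acts on a bilinear product through a twisted Leibniz rule, then vectors killed by powers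
of the two twisting operators have a product killed by a power of `F`. -/
theorem Module.End.pow_apply_bilin_eq_zero {R M : Type*} [CommRing R] [AddCommGroup M] [Module R M]
    (B : M →ₗ[R] M →ₗ[R] M) {F N P g h : End R M} (hN : Commute N h) (hP : Commute P g)
    (hF : ∀ x y, F (B x y) = B (N x) (g y) + B (h x) (P y)) (a b : ℕ) :
    ∀ x y, (N ^ a) x = 0 → (P ^ b) y = 0 → (F ^ (a + b)) (B x y) = 0 := by
  induction hn : a + b generalizing a b with
  | zero =>
    intro x y hx _
    obtain rfl : a = 0 := by omega
    simp_all
  | succ n ih =>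
    intro x y hx hy
    obtain _ | a := a
    · simp_all
    obtain _ | b := b
    · simp_all
    rw [pow_succ, Module.End.mul_apply, hF, map_add,
      ih a (b + 1) (by omega), ih (a + 1) b (by omega), add_zero]
    · rw [← Module.End.mul_apply, (hN.pow_left _).eq, Module.End.mul_apply, hx, map_zero]
    · rwa [← Module.End.mul_apply, ← pow_succ]
    · rwa [← Module.End.mul_apply, ← pow_succ]
    · rw [← Module.End.mul_apply, (hP.pow_left _).eq, Module.End.mul_apply, hy, map_zero]

theorem AddGroup.FG.exists_addMonoidHom_ne_zero (Γ : Type*) [AddCommGroup Γ] [AddGroup.FG Γ]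
    {E : Set Γ} (hE : E.Finite) :
    ∃ φ : Γ →+ ℤ, ∀ a ∈ E, ¬ IsOfFinAddOrder a → φ a ≠ 0 := by
  classical
  have : Module.Finite ℤ Γ := Module.Finite.iff_addGroup_fg.mpr inferInstance
  let T := Submodule.torsion ℤ Γ
  let b := Module.finBasis ℤ (Γ ⧸ T)
  let Q : Γ ⧸ T →ₗ[ℤ] ℤ[X] := b.constr ℤ fun i ↦ X ^ (i : ℕ)
  have hQ : Function.Injective Q := by
    rw [injective_iff_map_eq_zero]
    intro x hx
    refine b.ext_elem fun i ↦ ?_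
    have h := congrArg (fun q : ℤ[X] ↦ q.coeff i) hx
    simpa [Q, Basis.constr_apply_fintype, finsetSum_coeff, coeff_X_pow, Fin.val_inj] using h
  obtain ⟨t, ht⟩ : ∃ t : ℤ, ∀ a ∈ E, Q (T.mkQ a) ≠ 0 → (Q (T.mkQ a)).eval t ≠ 0 := by
    let q : ℤ[X] := ∏ a ∈ hE.toFinset, if Q (T.mkQ a) = 0 then 1 else Q (T.mkQ a)
    have hq : q ≠ 0 := Finset.prod_ne_zero_iff.mpr fun a _ ↦ by split_ifs <;> simp_all
    obtain ⟨t, ht⟩ : ∃ t : ℤ, q.eval t ≠ 0 := by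
      by_contra! h
      exact hq (Polynomial.funext (by simpa using h))
    refine ⟨t, fun a haE ha ↦ ?_⟩
    rw [eval_prod, Finset.prod_ne_zero_iff] at ht
    have := ht a (hE.mem_toFinset.mpr haE)
    rwa [if_neg ha] at this
  refine ⟨((Polynomial.leval t).comp (Q.comp T.mkQ)).toAddMonoidHom, fun a ha hfo ↦
    ht a ha fun h0 ↦ hfo ?_⟩
  have h1 : T.mkQ a = 0 := hQ (by rw [h0, map_zero])
  rw [Submodule.mkQ_apply, Submodule.Quotient.mk_eq_zero] at h1
  obtain ⟨⟨n, hn⟩, hna⟩ := h1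
  rw [isOfFinAddOrder_iff_zsmul_eq_zero]
  exact ⟨n, nonZeroDivisors.ne_zero hn, hna⟩

theorem AddSubgroup.exists_addMonoidHom_closure_ne_zero {M : Type*} [AddCommGroup M] {E : Set M}
    (hE : E.Finite) :
    ∃ φ : AddSubgroup.closure E →+ ℤ, ∀ a (ha : a ∈ E), ¬ IsOfFinAddOrder a →
      φ ⟨a, AddSubgroup.subset_closure ha⟩ ≠ 0 := by
  have := hE.to_subtype
  have : AddGroup.FG (AddSubgroup.closure E) := AddGroup.closure_finite_fg E
  obtain ⟨φ, hφ⟩ := AddGroup.FG.exists_addMonoidHom_ne_zero (AddSubgroup.closure E)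
    (hE.preimage (f := Subtype.val) Subtype.val_injective.injOn)
  exact ⟨φ, fun a ha h ↦ hφ _ ha fun h' ↦
    h (AddMonoidHom.isOfFinAddOrder (AddSubgroup.subtype _) h')⟩

theorem Polynomial.exists_pow_dvd_sub_C {L : Type*} [Field L] (E : Finset L) (χ : L → L) (n : ℕ) :
    ∃ P : L[X], ∀ α ∈ E, (X - C α) ^ n ∣ P - C (χ α) := by
  classical
  induction E using Finset.induction_on with
  | empty => exact ⟨0, by simp⟩
  | insert a s ha ih =>
    obtain ⟨P, hP⟩ := ih
    have hco : IsCoprime ((X - C a) ^ n) (∏ α ∈ s, (X - C α) ^ n) := by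
      refine IsCoprime.prod_right fun α hα ↦ IsCoprime.pow ?_
      exact isCoprime_X_sub_C_of_isUnit_sub
        (sub_ne_zero.mpr (ne_of_mem_of_not_mem hα ha).symm).isUnit
    obtain ⟨u, v, huv⟩ := hco
    refine ⟨P + v * (∏ α ∈ s, (X - C α) ^ n) * (C (χ a) - P), fun α hα ↦ ?_⟩
    obtain rfl | hα := Finset.mem_insert.mp hα
    · refine ⟨u * (P - C (χ α)), ?_⟩
      linear_combination (C (χ α) - P) * huv
    · have h1 : (X - C α) ^ n ∣ ∏ α ∈ s, (X - C α) ^ n := Finset.dvd_prod_of_mem _ hα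
      rw [add_sub_right_comm]
      exact dvd_add (hP α hα) ((h1.mul_left v).mul_right _)

theorem Module.End.aeval_apply_of_mem_maxGenEigenspace {L V : Type*} [Field L] [AddCommGroup V]
    [Module L V] [FiniteDimensional L V] {g : End L V} {P : L[X]} {α c : L}
    (hP : (X - C α) ^ finrank L V ∣ P - C c) {x : V} (hx : x ∈ g.maxGenEigenspace α) :
    aeval g P x = c • x := by
  rw [maxGenEigenspace_eq_genEigenspace_finrank, mem_genEigenspace_nat] at hx
  obtain ⟨q, hq⟩ := hP
  have h : aeval g (P - C c) x = 0 := by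
    rw [hq, mul_comm, map_mul, Module.End.mul_apply]
    have : aeval g ((X - C α) ^ finrank L V) x = 0 := by
      simpa [Algebra.algebraMap_eq_smul_one] using hx
    rw [this, map_zero]
  simpa [sub_eq_zero, Algebra.algebraMap_eq_smul_one] using h

theorem Module.End.exists_hasEigenvector_mem {L V : Type*} [Field L] [IsAlgClosed L]
    [AddCommGroup V] [Module L V] [FiniteDimensional L V] {g : End L V} {U : Submodule L V}
    (hU : ∀ x ∈ U, g x ∈ U) {x : V} (hxU : x ∈ U) (hx : x ≠ 0) :
    ∃ α, ∃ y ∈ U, g.HasEigenvector α y := by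
  have : Nontrivial U := ⟨⟨x, hxU⟩, 0, by simpa [Subtype.ext_iff] using hx⟩
  obtain ⟨α, hα⟩ := Module.End.exists_eigenvalue (g.restrict hU)
  obtain ⟨y, hy⟩ := hα.exists_hasEigenvector
  refine ⟨α, y, y.2, ?_⟩
  rw [hasEigenvector_iff, mem_eigenspace_iff] at hy ⊢
  exact ⟨congrArg Subtype.val hy.1, by simpa using hy.2⟩

theorem Module.End.hasEigenvalue_of_mem_maxGenEigenspace {L V : Type*} [Field L] [AddCommGroup V]
    [Module L V] {g : End L V} {α : L} {x : V} (hx : x ∈ g.maxGenEigenspace α) (hx0 : x ≠ 0) :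
    g.HasEigenvalue α := by
  have h : g.HasUnifEigenvalue α ⊤ := (Submodule.ne_bot_iff _).mpr ⟨x, hx, hx0⟩
  exact h.lt zero_lt_one

/-- Bilinear maps are determined by their values on pairs of generalized eigenvectors. -/
theorem LinearMap.ext_maxGenEigenspace₂ {L V W : Type*} [Field L] [IsAlgClosed L] [AddCommGroup V]
    [Module L V] [FiniteDimensional L V] [AddCommGroup W] [Module L W] (g : End L V)
    {B B' : V →ₗ[L] V →ₗ[L] W}
    (h : ∀ α β, ∀ x ∈ g.maxGenEigenspace α, ∀ y ∈ g.maxGenEigenspace β,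
      g.HasEigenvalue α → g.HasEigenvalue β → B x y = B' x y) : B = B' := by
  ext x y
  have hx : x ∈ ⨆ α, g.maxGenEigenspace α := g.iSup_maxGenEigenspace_eq_top ▸ trivial
  have hy : y ∈ ⨆ α, g.maxGenEigenspace α := g.iSup_maxGenEigenspace_eq_top ▸ trivial
  induction hx using Submodule.iSup_induction' with
  | zero => simp
  | add x x' _ _ h h' => simp [h, h']
  | mem α x hx =>
    induction hy using Submodule.iSup_induction' with
    | zero => simp
    | add y y' _ _ h h' => simp [h, h']
    | mem β y hy =>
      by_cases hx0 : x = 0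
      · simp [hx0]
      by_cases hy0 : y = 0
      · simp [hy0]
      exact h α β x hx y hy (End.hasEigenvalue_of_mem_maxGenEigenspace hx hx0)
        (End.hasEigenvalue_of_mem_maxGenEigenspace hy hy0)

section Bracket

variable {L V : Type*} [Field L] [LieRing V] [LieAlgebra L V]

theorem lie_mem_maxGenEigenspace_mul {f : End L V} (hf : ∀ x y, f ⁅x, y⁆ = ⁅f x, f y⁆) {α β : L}
    {x y : V} (hx : x ∈ f.maxGenEigenspace α) (hy : y ∈ f.maxGenEigenspace β) :
    ⁅x, y⁆ ∈ f.maxGenEigenspace (α * β) := by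
  rw [End.mem_maxGenEigenspace] at hx hy ⊢
  obtain ⟨a, ha⟩ := hx
  obtain ⟨b, hb⟩ := hy
  refine ⟨a + b, End.pow_apply_bilin_eq_zero (LieModule.toEnd L V V : V →ₗ[L] End L V)
    (g := f) (h := α • 1) ?_ ?_ ?_ a b x y ha hb⟩
  · exact (Commute.one_right _).smul_right α
  · exact (Commute.refl f).sub_left ((Commute.one_left _).smul_left β)
  · intro x y
    simp [hf, smul_sub, smul_smul]

theorem lie_mem_maxGenEigenspace_add {δ : End L V} (hδ : ∀ x y, δ ⁅x, y⁆ = ⁅δ x, y⁆ + ⁅x, δ y⁆)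
    {α β : L} {x y : V} (hx : x ∈ δ.maxGenEigenspace α) (hy : y ∈ δ.maxGenEigenspace β) :
    ⁅x, y⁆ ∈ δ.maxGenEigenspace (α + β) := by
  rw [End.mem_maxGenEigenspace] at hx hy ⊢
  obtain ⟨a, ha⟩ := hx
  obtain ⟨b, hb⟩ := hy
  refine ⟨a + b, End.pow_apply_bilin_eq_zero (LieModule.toEnd L V V : V →ₗ[L] End L V)
    (g := 1) (h := 1) (Commute.one_right _) (Commute.one_right _) ?_ a b x y ha hb⟩
  intro x y
  simp [hδ, add_smul]
  abel

/-- The integral eigenspaces of a diagonalizable derivation form a grading. -/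
theorem isLieGrading_eigenspace [CharZero L] {D : End L V}
    (hD : ∀ x y, D ⁅x, y⁆ = ⁅D x, y⁆ + ⁅x, D y⁆)
    (htop : ⨆ k : ℤ, D.eigenspace (k : L) = ⊤) :
    IsLieGrading L V fun k ↦ D.eigenspace (k : L) := by
  classical
  refine ⟨DirectSum.isInternal_submodule_of_iSupIndep_of_iSup_eq_top
    (D.eigenspaces_iSupIndep.comp Int.cast_injective) htop, fun i j x hx y hy ↦ ?_⟩
  rw [End.mem_eigenspace_iff] at hx hy ⊢
  simp [hD, hx, hy, add_smul]

theorem hasSpecialGrading_of_no_finite_order_eigenvalue [IsAlgClosed L] [CharZero L]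
    [FiniteDimensional L V] {f : End L V} (hf : ∀ x y, f ⁅x, y⁆ = ⁅f x, f y⁆)
    (hinj : Function.Injective f)
    (hz : ∀ x ∈ LieAlgebra.center L V, ∀ μ : L, f x = μ • x → IsOfFinOrder μ → x = 0) :
    HasSpecialGrading L V := by
  classical
  let E : Set (Additive Lˣ) := {a | f.HasEigenvalue (a.toMul : L)}
  have hE : E.Finite := by
    refine (Module.End.finite_hasEigenvalue f).preimage
      (f := fun a : Additive Lˣ ↦ (a.toMul : L)) ?_
    exact fun a _ b _ h ↦ Additive.toMul.injective (Units.ext h)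
  obtain ⟨φ, hφ⟩ := AddSubgroup.exists_addMonoidHom_closure_ne_zero hE
  have hunit : ∀ α, f.HasEigenvalue α → ∃ a : Additive Lˣ, a ∈ E ∧ (a.toMul : L) = α := by
    intro α hα
    have hα0 : α ≠ 0 := by
      rintro rfl
      obtain ⟨x, hx⟩ := hα.exists_hasEigenvector
      exact hx.2 (hinj (by simpa using hx.apply_eq_smul))
    exact ⟨Additive.ofMul (Units.mk0 α hα0), hα, rfl⟩
  let χ (α : L) : ℤ := if h : ∃ a : Additive Lˣ, a ∈ E ∧ (a.toMul : L) = α then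
    φ ⟨h.choose, AddSubgroup.subset_closure h.choose_spec.1⟩ else 0
  have hχ (a : Additive Lˣ) (ha : a ∈ E) :
      χ (a.toMul : L) = φ ⟨a, AddSubgroup.subset_closure ha⟩ := by
    have h : ∃ b : Additive Lˣ, b ∈ E ∧ (b.toMul : L) = a.toMul := ⟨a, ha, rfl⟩
    have h2 : h.choose = a := Additive.toMul.injective (Units.ext h.choose_spec.2)
    simp only [χ, dif_pos h]
    congr
  obtain ⟨P, hP⟩ := Polynomial.exists_pow_dvd_sub_C (Module.End.finite_hasEigenvalue f).toFinset
    (fun α ↦ (χ α : L)) (finrank L V)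
  let D : End L V := aeval f P
  have hDW {α : L} {x : V} (hx : x ∈ f.maxGenEigenspace α) : D x = (χ α : L) • x := by
    by_cases hx0 : x = 0
    · simp [hx0]
    refine End.aeval_apply_of_mem_maxGenEigenspace (hP α ?_) hx
    simpa using End.hasEigenvalue_of_mem_maxGenEigenspace hx hx0
  have hD : ∀ x y, D ⁅x, y⁆ = ⁅D x, y⁆ + ⁅x, D y⁆ := by
    let B : V →ₗ[L] V →ₗ[L] V := (LieModule.toEnd L V V : V →ₗ[L] End L V)
    suffices B.compr₂ D = B.comp D + B.compl₂ D from
      fun x y ↦ LinearMap.congr_fun₂ this x y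
    refine LinearMap.ext_maxGenEigenspace₂ f fun α β x hx y hy hα hβ ↦ ?_
    change D ⁅x, y⁆ = ⁅D x, y⁆ + ⁅x, D y⁆
    have hxy := lie_mem_maxGenEigenspace_mul hf hx hy
    by_cases h0 : ⁅x, y⁆ = 0
    · simp [hDW hx, hDW hy, h0]
    obtain ⟨a, ha, rfl⟩ := hunit α hα
    obtain ⟨b, hb, rfl⟩ := hunit β hβ
    have hab : a + b ∈ E := by
      simpa [E] using End.hasEigenvalue_of_mem_maxGenEigenspace hxy h0
    have hadd : χ (a.toMul * b.toMul : L) = χ a.toMul + χ b.toMul := by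
      rw [hχ a ha, hχ b hb, ← map_add]
      simpa using hχ (a + b) hab
    rw [hDW hx, hDW hy, hDW hxy, hadd]
    simp [add_smul]
  refine ⟨_, isLieGrading_eigenspace hD ?_, ?_⟩
  · rw [eq_top_iff, ← f.iSup_maxGenEigenspace_eq_top]
    refine iSup_le fun α ↦ le_iSup_of_le (χ α) fun x hx ↦ ?_
    exact End.mem_eigenspace_iff.mpr (hDW hx)
  · rw [eq_bot_iff]
    rintro x ⟨hx, hxz⟩
    by_contra hx0
    have hsurj : Function.Surjective f := LinearMap.injective_iff_surjective.mp hinj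
    have hU : ∀ z ∈ D.eigenspace ((0 : ℤ) : L) ⊓ (LieAlgebra.center L V).toSubmodule,
        f z ∈ D.eigenspace ((0 : ℤ) : L) ⊓ (LieAlgebra.center L V).toSubmodule := by
      rintro z ⟨hz1, hz2⟩
      refine ⟨?_, ?_⟩
      · have hcomm : Commute D f := by simpa [D] using (Commute.all P X).map (aeval f)
        simp only [SetLike.mem_coe, End.mem_eigenspace_iff] at hz1 ⊢
        rw [← End.mul_apply, hcomm.eq, End.mul_apply, hz1, map_smul]
      · intro w
        obtain ⟨w, rfl⟩ := hsurj w
        rw [← hf, hz2 w, map_zero]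
    obtain ⟨α, y, ⟨hy, hyz⟩, hyα⟩ := End.exists_hasEigenvector_mem hU ⟨hx, hxz⟩ hx0
    obtain ⟨a, ha, rfl⟩ := hunit α (End.hasEigenvalue_of_hasEigenvector hyα)
    refine hyα.2 (hz y hyz _ hyα.apply_eq_smul ?_)
    have h1 : D y = _ := hDW (End.eigenspace_le_maxGenEigenspace hyα.1)
    rw [End.mem_eigenspace_iff.mp hy] at h1
    have h2 : χ (a.toMul : L) = 0 := by
      have := smul_left_injective L hyα.2 h1
      exact_mod_cast this.symm
    rw [hχ a ha] at h2
    by_contra hfin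
    refine hφ a ha (fun h ↦ hfin ?_) h2
    exact (Units.coeHom L).isOfFinOrder (isOfFinAddOrder_ofMul_iff.mp h)

end Bracket

section BaseChange

variable {k A V : Type*} [Field k] [Field A] [Algebra k A]

/-- The contraction `A ⊗ V → V` along a linear functional on `A`. -/
noncomputable def TensorProduct.contractLinear [AddCommGroup V] [Module k V] (l : A →ₗ[k] k) :
    A ⊗[k] V →ₗ[k] V :=
  TensorProduct.lid k V ∘ₗ l.rTensor V

@[simp]
theorem TensorProduct.contractLinear_tmul [AddCommGroup V] [Module k V] (l : A →ₗ[k] k) (a : A)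
    (v : V) : contractLinear l (a ⊗ₜ v) = l a • v := by
  simp [contractLinear]

theorem Submodule.mem_baseChange_of_contractLinear_mem [AddCommGroup V] [Module k V]
    {p : Submodule k V} {z : A ⊗[k] V}
    (h : ∀ l : A →ₗ[k] k, TensorProduct.contractLinear l z ∈ p) : z ∈ p.baseChange A := by
  classical
  let B := Basis.ofVectorSpace k A
  obtain ⟨c, rfl⟩ := TensorProduct.eq_repr_basis_left B z
  refine sum_mem fun i _ ↦ tmul_mem_baseChange_of_mem _ ?_
  have := h (B.coord i)
  by_cases hi : c i = 0
  · simp [hi]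
  · simpa [Finsupp.sum, Finsupp.single_apply, hi] using this

theorem LinearMap.baseChange_injOn [AddCommGroup V] [Module k V] {p : Submodule k V}
    {g : End k V} (hg : ∀ z ∈ p, g z = 0 → z = 0) {x : A ⊗[k] V} (hx : x ∈ p.baseChange A)
    (hgx : g.baseChange A x = 0) : x = 0 := by
  obtain ⟨w, rfl⟩ : ∃ w : A ⊗[k] p, p.subtype.baseChange A w = x := hx
  have hinj : Function.Injective (g ∘ₗ p.subtype) := by
    rw [injective_iff_map_eq_zero]
    exact fun z hz ↦ Subtype.ext (hg z z.2 hz)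
  have h2 : (g ∘ₗ p.subtype).lTensor A w = 0 := by
    rw [LinearMap.lTensor_comp]
    exact hgx
  have := Module.Flat.lTensor_preserves_injective_linearMap (M := A) _ hinj
    (h2.trans (map_zero _).symm)
  rw [this, map_zero]

variable [LieRing V] [LieAlgebra k V]

theorem LieAlgebra.contractLinear_lie (l : A →ₗ[k] k) (y : V) (z : A ⊗[k] V) :
    TensorProduct.contractLinear l ⁅(1 : A) ⊗ₜ[k] y, z⁆ =
      ⁅y, TensorProduct.contractLinear l z⁆ := by
  induction z with
  | zero => simp
  | add z w hz hw => simp [hz, hw]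
  | tmul a v => simp

theorem LieAlgebra.mem_baseChange_center_iff {z : A ⊗[k] V} :
    z ∈ (center k V).toSubmodule.baseChange A ↔ z ∈ center A (A ⊗[k] V) := by
  constructor
  · intro hz
    rw [Submodule.baseChange_eq_span] at hz
    induction hz using Submodule.span_induction with
    | zero => exact zero_mem _
    | add x y _ _ hx hy => exact add_mem hx hy
    | smul a x _ hx => exact (center A (A ⊗[k] V)).smul_mem a hx
    | mem x hx =>
      obtain ⟨v, hv, rfl⟩ := hx
      intro y
      induction y with
      | zero => simp
      | add x y hx hy => rw [add_lie, hx, hy, add_zero]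
      | tmul a w => simp [show ⁅w, v⁆ = 0 from hv w]
  · intro hz
    refine Submodule.mem_baseChange_of_contractLinear_mem fun l y ↦ ?_
    rw [← contractLinear_lie, show ⁅(1 : A) ⊗ₜ[k] y, z⁆ = 0 from hz _, map_zero]

theorem LinearMap.baseChange_lie {f : End k V} (hf : ∀ x y, f ⁅x, y⁆ = ⁅f x, f y⁆)
    (x y : A ⊗[k] V) :
    f.baseChange A ⁅x, y⁆ = ⁅f.baseChange A x, f.baseChange A y⁆ := by
  induction x with
  | zero => simp
  | add x x' hx hx' => simp [hx, hx']
  | tmul a v =>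
    induction y with
    | zero => simp
    | add y y' hy hy' => simp [hy, hy']
    | tmul b w => simp [hf]

theorem LinearMap.baseChange_leibniz {δ : End k V} (hδ : ∀ x y, δ ⁅x, y⁆ = ⁅δ x, y⁆ + ⁅x, δ y⁆)
    (x y : A ⊗[k] V) :
    δ.baseChange A ⁅x, y⁆ = ⁅δ.baseChange A x, y⁆ + ⁅x, δ.baseChange A y⁆ := by
  induction x with
  | zero => simp
  | add x x' hx hx' => simp [hx, hx']; abel
  | tmul a v =>
    induction y with
    | zero => simp
    | add y y' hy hy' => simp [hy, hy']; abel
    | tmul b w => simp [hδ, tmul_add]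

/-- A nonsingular matrix over an extension field can be specialised to a nonsingular one over the
base field by a linear functional. -/
theorem Matrix.exists_linearMap_det_map_ne_zero [Infinite k] {n : Type*} [Fintype n]
    [DecidableEq n] {M : Matrix n n A} (hM : M.det ≠ 0) :
    ∃ l : A →ₗ[k] k, (M.map l).det ≠ 0 := by
  let B := Basis.ofVectorSpace k A
  let Q : A →ₗ[k] MvPolynomial _ k := B.constr k MvPolynomial.X
  have hQ (a : A) : MvPolynomial.aeval B (Q a) = a := by
    have : (MvPolynomial.aeval B).toLinearMap ∘ₗ Q = LinearMap.id :=
      B.ext fun i ↦ by simp [Q]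
    exact LinearMap.congr_fun this a
  have hdet : (M.map Q).det ≠ 0 := by
    intro h
    apply hM
    have h2 := congrArg (MvPolynomial.aeval B) h
    rw [AlgHom.map_det, map_zero] at h2
    rw [← h2]
    congr 1
    ext i j
    simp [hQ]
  obtain ⟨t, ht⟩ : ∃ t, MvPolynomial.eval t (M.map Q).det ≠ 0 := by
    by_contra! h
    exact hdet (MvPolynomial.funext (by simpa using h))
  refine ⟨(MvPolynomial.aeval t).toLinearMap ∘ₗ Q, ?_⟩
  rw [RingHom.map_det] at ht
  exact ht

theorem LieAlgebra.exists_derivation_injOn_center [Infinite k] [FiniteDimensional k V]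
    {D : End A (A ⊗[k] V)} (hD : ∀ x y, D ⁅x, y⁆ = ⁅D x, y⁆ + ⁅x, D y⁆)
    (hz : ∀ x ∈ center A (A ⊗[k] V), D x = 0 → x = 0) :
    ∃ δ : End k V, (∀ x y, δ ⁅x, y⁆ = ⁅δ x, y⁆ + ⁅x, δ y⁆) ∧
      ∀ z ∈ center k V, δ z = 0 → z = 0 := by
  let Z := (center k V).toSubmodule
  let b := Module.finBasis k Z
  let bA := Algebra.TensorProduct.basis A b
  obtain ⟨r, hr⟩ := Z.subtype.exists_leftInverse_of_injective Z.ker_subtype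
  let T : End A (A ⊗[k] Z) := r.baseChange A ∘ₗ D ∘ₗ Z.subtype.baseChange A
  have hrA (w : A ⊗[k] Z) : r.baseChange A (Z.subtype.baseChange A w) = w := by
    rw [← LinearMap.comp_apply, ← LinearMap.baseChange_comp, hr, LinearMap.baseChange_id,
      LinearMap.id_apply]
  have hrange (x : A ⊗[k] V) :
      x ∈ center A (A ⊗[k] V) ↔ ∃ w, Z.subtype.baseChange A w = x := by
    rw [← mem_baseChange_center_iff]
    rfl
  have hT : LinearMap.ker T = ⊥ := by
    rw [LinearMap.ker_eq_bot']
    intro w hw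
    have hc := (hrange _).mpr ⟨w, rfl⟩
    have hDc : D (Z.subtype.baseChange A w) ∈ center A (A ⊗[k] V) := by
      intro y
      have h1 := hD y (Z.subtype.baseChange A w)
      rwa [hc y, hc (D y), map_zero, zero_add, eq_comm] at h1
    obtain ⟨w', hw'⟩ := (hrange _).mp hDc
    have h0 : w' = 0 := by
      rw [← hrA w', hw']
      exact hw
    rw [← hrA w, hz _ hc (by rw [← hw', h0, map_zero]), map_zero]
  have hdet : (LinearMap.toMatrix bA bA T).det ≠ 0 := by
    rw [LinearMap.det_toMatrix]
    exact fun h ↦ (LinearMap.bot_lt_ker_of_det_eq_zero h).ne' hT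
  obtain ⟨l, hl⟩ := Matrix.exists_linearMap_det_map_ne_zero (k := k) hdet
  let δ : End k V := TensorProduct.contractLinear l ∘ₗ D.restrictScalars k ∘ₗ
    TensorProduct.mk k A V 1
  have hδ (x : V) : δ x = TensorProduct.contractLinear l (D (1 ⊗ₜ x)) := rfl
  refine ⟨δ, fun x y ↦ ?_, fun z hzc hδz ↦ ?_⟩
  · have h1 := hD (1 ⊗ₜ x) (1 ⊗ₜ y)
    rw [← lie_skew (D (1 ⊗ₜ x))] at h1
    rw [ExtendScalars.bracket_tmul, one_mul] at h1
    rw [hδ, h1, map_add, map_neg, contractLinear_lie, contractLinear_lie, hδ, hδ,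
      lie_skew]
  · have hrepr (w : A ⊗[k] Z) (i) :
        b.repr (TensorProduct.contractLinear l w) i = l (bA.repr w i) := by
      induction w with
      | zero => simp
      | add x y hx hy => simp [hx, hy]
      | tmul a v =>
        simp only [TensorProduct.contractLinear_tmul, map_smul, Finsupp.smul_apply, smul_eq_mul,
          bA, Algebra.TensorProduct.basis_repr_tmul, Finsupp.mapRange_apply]
        rw [mul_comm a, ← Algebra.smul_def, map_smul, smul_eq_mul, mul_comm]
    have hcontr (w : A ⊗[k] V) : r (TensorProduct.contractLinear l w) =
        TensorProduct.contractLinear l (r.baseChange A w) := by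
      induction w with
      | zero => simp
      | add x y hx hy => simp [hx, hy]
      | tmul a v => simp
    have hmat : LinearMap.toMatrix b b (r ∘ₗ δ ∘ₗ Z.subtype) =
        (LinearMap.toMatrix bA bA T).map l := by
      ext i j
      rw [Matrix.map_apply, LinearMap.toMatrix_apply, LinearMap.toMatrix_apply, ← hrepr]
      simp [T, bA, hδ, hcontr]
    rw [← hmat, LinearMap.det_toMatrix] at hl
    have hker : LinearMap.ker (r ∘ₗ δ ∘ₗ Z.subtype) = ⊥ := by
      by_contra h
      exact hl (LinearMap.det_eq_zero_iff_ker_ne_bot.mpr h)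
    have := (LinearMap.ker_eq_bot'.mp hker) ⟨z, hzc⟩ (by simp [hδz])
    exact congrArg Subtype.val this

end BaseChange

theorem IsLieGrading.exists_derivation {K 𝔪 : Type*} [Field K] [CharZero K] [LieRing 𝔪]
    [LieAlgebra K 𝔪] {p : ℤ → Submodule K 𝔪} (h : IsLieGrading K 𝔪 p) :
    ∃ D : End K 𝔪, (∀ x y, D ⁅x, y⁆ = ⁅D x, y⁆ + ⁅x, D y⁆) ∧ ∀ x, D x = 0 → x ∈ p 0 := by
  classical
  let e := LinearEquiv.ofBijective (DirectSum.coeLinearMap p) h.1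
  let D : End K 𝔪 := e.toLinearMap ∘ₗ
    DirectSum.lmap (fun k : ℤ ↦ (k : K) • (LinearMap.id : p k →ₗ[K] p k)) ∘ₗ e.symm.toLinearMap
  have he (k : ℤ) (x : p k) : e (DirectSum.lof K ℤ (fun i ↦ p i) k x) = x :=
    DirectSum.coeLinearMap_lof p k x
  have hD (k : ℤ) (x : 𝔪) (hx : x ∈ p k) : D x = (k : K) • x := by
    have : e.symm x = DirectSum.lof K ℤ (fun i ↦ p i) k ⟨x, hx⟩ := by
      rw [LinearEquiv.symm_apply_eq, he]
    simp [D, this, he]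
  have htop (x : 𝔪) : x ∈ ⨆ k, p k := h.1.submodule_iSup_eq_top ▸ trivial
  refine ⟨D, fun x y ↦ ?_, fun x hx ↦ ?_⟩
  · have hx := htop x
    have hy := htop y
    induction hx using Submodule.iSup_induction' with
    | zero => simp
    | add x x' _ _ h h' => simp [h, h']; abel
    | mem i x hx =>
      induction hy using Submodule.iSup_induction' with
      | zero => simp
      | add y y' _ _ h h' => simp [h, h']; abel
      | mem j y hy =>
        rw [hD i x hx, hD j y hy, hD (i + j) _ (h.2 i j x hx y hy)]
        simp [add_smul]
  · obtain ⟨u, rfl⟩ := e.surjective x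
    have hu : DirectSum.lmap (fun k : ℤ ↦ (k : K) • (LinearMap.id : p k →ₗ[K] p k)) u = 0 := by
      simpa [D] using hx
    have hu' (i : ℤ) (hi : i ≠ 0) : u i = 0 := by
      have := DFunLike.congr_fun hu i
      change (i : K) • u i = 0 at this
      simpa [hi] using this
    have : u = DirectSum.lof K ℤ (fun i ↦ p i) 0 (u 0) := by
      ext i
      by_cases hi : i = 0
      · subst hi
        simp [DirectSum.lof_eq_of]
      · rw [hu' i hi, DirectSum.lof_eq_of, DirectSum.of_eq_of_ne _ _ _ hi]
    rw [this, he]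
    exact (u 0).2

section NumberField

open NumberField

namespace NumberField.RingOfIntegers

theorem exists_int_ne_zero_mem {K : Type*} [Field K] {I : Ideal (𝓞 K)} (hI : I ≠ ⊥) :
    ∃ b : ℤ, b ≠ 0 ∧ (b : 𝓞 K) ∈ I := by
  obtain ⟨x, hx, hx0⟩ := Submodule.exists_mem_ne_zero_of_ne_bot hI
  obtain ⟨b, hb, hb0⟩ := Submodule.exists_mem_ne_zero_of_ne_bot
    (Ideal.comap_ne_bot_of_integral_mem (R := ℤ) hx0 hx (Algebra.IsIntegral.isIntegral x))
  exact ⟨b, hb0, by simpa using hb⟩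

variable {K : Type*} [Field K] [NumberField K]

theorem exists_not_isUnit_one_sub_natCast_mul [IsGalois ℚ K] {x : 𝓞 K} (hx : x ≠ 0) :
    ∃ k : ℕ, ¬ IsUnit (1 - k * x) := by
  by_contra! h
  let Q : K[X] := ∏ σ : Gal(K/ℚ), (1 - X * C (σ x))
  have hσ (σ : Gal(K/ℚ)) : σ x ≠ 0 := by simpa using hx
  have hdeg (σ : Gal(K/ℚ)) : (1 - X * C (σ (x : K))).natDegree = 1 := by
    rw [← natDegree_neg, neg_sub, ← C_1, natDegree_sub_C, natDegree_X_mul (C_ne_zero.mpr (hσ σ)),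
      natDegree_C]
  have hQdeg : Q.natDegree ≠ 0 := by
    have h0 (σ : Gal(K/ℚ)) : 1 - X * C (σ (x : K)) ≠ 0 := by
      intro h
      have := hdeg σ
      rw [h, natDegree_zero] at this
      exact zero_ne_one this
    rw [natDegree_prod _ _ fun σ _ ↦ h0 σ, Finset.sum_congr rfl fun σ _ ↦ hdeg σ]
    simp
  have heval (k : ℕ) : (Q ^ 2).eval (k : K) = 1 := by
    have h1 := isUnit_iff_norm.mp (h k)
    have h2 : Q.eval (k : K) = algebraMap ℚ K (Algebra.norm ℚ ((1 - k * x : 𝓞 K) : K)) := by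
      rw [Algebra.norm_eq_prod_automorphisms, eval_prod]
      refine Finset.prod_congr rfl fun σ _ ↦ ?_
      simp [mul_comm (k : K)]
    rw [RingOfIntegers.coe_norm] at h1
    rw [eval_pow, h2, ← map_pow, ← sq_abs, h1]
    simp
  have hQ : Q ^ 2 = 1 := by
    refine Polynomial.eq_of_infinite_eval_eq _ _
      ((Set.infinite_range_of_injective (Nat.cast_injective (R := K))).mono ?_)
    rintro _ ⟨k, rfl⟩
    exact (heval k).trans eval_one.symm
  have := congrArg natDegree hQ
  rw [natDegree_pow, natDegree_one] at this
  omega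

variable (K) in
theorem exists_galois_smul_ne :
    ∃ θ : 𝓞 K, θ ≠ 0 ∧ ∀ τ : Gal(K/ℚ), τ ≠ 1 → τ • θ ≠ θ := by
  obtain ⟨a, ha⟩ := Field.exists_primitive_element ℚ K
  have halg : IsAlgebraic ℤ a := (IsFractionRing.isAlgebraic_iff ℤ ℚ K).mpr
    (Algebra.IsAlgebraic.isAlgebraic a)
  obtain ⟨y, hy, hint⟩ := halg.exists_integral_multiple
  have key (τ : Gal(K/ℚ)) (h : τ a = a) : τ = 1 := by
    ext x
    have hx : x ∈ IntermediateField.adjoin ℚ {a} := ha ▸ IntermediateField.mem_top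
    induction hx using IntermediateField.adjoin_induction with
    | mem x hx => simpa [Set.mem_singleton_iff.mp hx] using h
    | algebraMap q => simp
    | add x y _ _ hx hy => simp_all
    | inv x _ hx => simp_all
    | mul x y _ _ hx hy => simp_all
  by_cases ha0 : a = 0
  · exact ⟨1, one_ne_zero, fun τ hτ ↦ (hτ (key τ (by simp [ha0]))).elim⟩
  refine ⟨⟨y • a, hint⟩, ?_, fun τ hτ h ↦ hτ (key τ ?_)⟩
  · intro h
    have : y • a = 0 := congrArg (algebraMap (𝓞 K) K) h
    simp [hy, ha0] at this
  · have : τ (y • a) = y • a := congrArg (algebraMap (𝓞 K) K) h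
    simpa [hy] using this

/-- There is a prime with trivial decomposition group avoiding a given nonzero integer. -/
theorem exists_maximal_comap_ne [IsGalois ℚ K] {c : ℤ} (hc : c ≠ 0) :
    ∃ P : Ideal (𝓞 K), P.IsMaximal ∧ P ≠ ⊥ ∧ (c : 𝓞 K) ∉ P ∧
      ∀ τ : Gal(K/ℚ), τ ≠ 1 → P.comap (MulSemiringAction.toRingHom _ (𝓞 K) τ) ≠ P := by
  classical
  obtain ⟨θ, hθ0, hθ⟩ := exists_galois_smul_ne K
  let d : 𝓞 K := ∏ τ : Gal(K/ℚ) with τ ≠ 1, (τ • θ - θ)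
  have hd : d ≠ 0 := Finset.prod_ne_zero_iff.mpr fun τ hτ ↦
    sub_ne_zero.mpr (hθ τ (by simpa using hτ))
  obtain ⟨b, hb0, hb⟩ := exists_int_ne_zero_mem (I := Ideal.span {d}) (by simpa using hd)
  obtain ⟨k, hk⟩ := exists_not_isUnit_one_sub_natCast_mul (x := ((c * b : ℤ) : 𝓞 K) * θ)
    (mul_ne_zero (Int.cast_ne_zero.mpr (mul_ne_zero hc hb0)) hθ0)
  obtain ⟨P, hP, hmem⟩ := exists_max_ideal_of_mem_nonunits hk
  have hkc : ((k * (c * b) : ℤ) : 𝓞 K) ∉ P := by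
    intro h
    refine hP.ne_top ((Ideal.eq_top_iff_one _).mpr ?_)
    have := P.add_mem hmem (P.mul_mem_right θ h)
    convert this using 1
    push_cast
    ring
  have hc' : (c : 𝓞 K) ∉ P := fun h ↦ hkc (by
    convert P.mul_mem_left ((k * b : ℤ) : 𝓞 K) h using 1
    push_cast
    ring)
  have hb' : (b : 𝓞 K) ∉ P := fun h ↦ hkc (by
    convert P.mul_mem_left ((k * c : ℤ) : 𝓞 K) h using 1
    push_cast
    ring)
  refine ⟨P, hP, ?_, hc', fun τ hτ h ↦ ?_⟩
  · exact Ring.ne_bot_of_isMaximal_of_not_isField hP (RingOfIntegers.not_isField K)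
  · have h1 : τ • (1 - (k : 𝓞 K) * (((c * b : ℤ) : 𝓞 K) * θ)) ∈ P := by
      rw [← h] at hmem
      exact hmem
    have h2 : ((k * (c * b) : ℤ) : 𝓞 K) * (τ • θ - θ) ∈ P := by
      convert P.sub_mem hmem h1 using 1
      have hint (z : ℤ) : τ • (z : 𝓞 K) = z := map_intCast (MulSemiringAction.toRingHom _ (𝓞 K) τ) z
      have hnat : τ • (k : 𝓞 K) = k := map_natCast (MulSemiringAction.toRingHom _ (𝓞 K) τ) k
      rw [smul_sub, smul_mul', smul_mul', smul_one, hint, hnat]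
      push_cast
      ring
    have h3 : τ • θ - θ ∈ P := (hP.isPrime.mem_or_mem h2).resolve_left hkc
    have h4 : d ∈ P := P.mem_of_dvd (Finset.dvd_prod_of_mem _ (by simpa using hτ)) h3
    exact hb' (P.mem_of_dvd (Ideal.mem_span_singleton.mp hb) h4)

theorem _root_.Ideal.exists_mem_forall_notMem {R ι : Type*} [CommRing R] [Finite ι] {P : Ideal R}
    [P.IsMaximal] {Q : ι → Ideal R} (hQ : ∀ i, (Q i).IsPrime) (hne : ∀ i, P ≠ Q i) :
    ∃ x ∈ P, ∀ i, x ∉ Q i := by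
  cases nonempty_fintype ι
  by_contra! h
  have hsub : (P : Set R) ⊆ ⋃ i ∈ (Finset.univ : Finset ι), Q i := fun x hx ↦ by
    simpa using h x hx
  obtain ⟨i₀, -⟩ := h 0 P.zero_mem
  obtain ⟨i, -, hi⟩ := (Ideal.subset_union_prime i₀ i₀ fun i _ _ _ ↦ hQ i).mp hsub
  exact hne i (Ideal.IsMaximal.eq_of_le inferInstance (hQ i).ne_top hi)


open IsDedekindDomain WithZero in
variable (K) in
theorem exists_valuation_galois [IsGalois ℚ K] :
    ∃ (π : K) (v w : Valuation K ℤᵐ⁰), π ≠ 0 ∧ (∀ x, IsIntegral ℤ x → v x ≤ 1) ∧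
      (∀ x, IsIntegral ℤ x → w x ≤ 1) ∧ v π < 1 ∧ 1 < w π ∧
      ∀ τ : Gal(K/ℚ), τ ≠ 1 → v (τ π) = 1 ∧ w (τ π) = 1 := by
  obtain ⟨P, hP, hP0, -, hPτ⟩ := exists_maximal_comap_ne (K := K) one_ne_zero
  obtain ⟨c, hc0, hc⟩ := exists_int_ne_zero_mem hP0
  obtain ⟨Q, hQ, hQ0, hcQ, hQτ⟩ := exists_maximal_comap_ne (K := K) hc0
  let s (τ : Gal(K/ℚ)) : 𝓞 K →+* 𝓞 K := MulSemiringAction.toRingHom _ (𝓞 K) τ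
  have hPQ (τ : Gal(K/ℚ)) : P ≠ Q.comap (s τ) := by
    rintro h
    rw [h, Ideal.mem_comap, map_intCast] at hc
    exact hcQ hc
  have hQP (τ : Gal(K/ℚ)) : Q ≠ P.comap (s τ) := by
    rintro rfl
    rw [Ideal.mem_comap, map_intCast] at hcQ
    exact hcQ hc
  obtain ⟨x, hx, hx'⟩ := Ideal.exists_mem_forall_notMem (P := P)
    (Q := Sum.elim (fun τ : {τ : Gal(K/ℚ) // τ ≠ 1} ↦ P.comap (s τ)) fun τ ↦ Q.comap (s τ))
    (by rintro (τ | τ) <;> exact Ideal.comap_isPrime _ _)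
    (by rintro (τ | τ); exacts [(hPτ τ τ.2).symm, hPQ τ])
  obtain ⟨y, hy, hy'⟩ := Ideal.exists_mem_forall_notMem (P := Q)
    (Q := Sum.elim (fun τ : {τ : Gal(K/ℚ) // τ ≠ 1} ↦ Q.comap (s τ)) fun τ ↦ P.comap (s τ))
    (by rintro (τ | τ) <;> exact Ideal.comap_isPrime _ _)
    (by rintro (τ | τ); exacts [(hQτ τ τ.2).symm, hQP τ])
  let v : HeightOneSpectrum (𝓞 K) := ⟨P, hP.isPrime, hP0⟩
  let w : HeightOneSpectrum (𝓞 K) := ⟨Q, hQ.isPrime, hQ0⟩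
  have hint (u : HeightOneSpectrum (𝓞 K)) (z : K) (hz : IsIntegral ℤ z) : u.valuation K z ≤ 1 :=
    u.valuation_le_one (⟨z, hz⟩ : 𝓞 K)
  have hvx (τ : Gal(K/ℚ)) (hτ : τ ≠ 1) : v.valuation K (τ x) = 1 :=
    (v.valuation_eq_one_iff_notMem (r := τ • x)).mpr (hx' (.inl ⟨τ, hτ⟩))
  have hwx (τ : Gal(K/ℚ)) : w.valuation K (τ x) = 1 :=
    (w.valuation_eq_one_iff_notMem (r := τ • x)).mpr (hx' (.inr τ))
  have hwy (τ : Gal(K/ℚ)) (hτ : τ ≠ 1) : w.valuation K (τ y) = 1 :=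
    (w.valuation_eq_one_iff_notMem (r := τ • y)).mpr (hy' (.inl ⟨τ, hτ⟩))
  have hvy (τ : Gal(K/ℚ)) : v.valuation K (τ y) = 1 :=
    (v.valuation_eq_one_iff_notMem (r := τ • y)).mpr (hy' (.inr τ))
  have hx0 : (x : K) ≠ 0 := by
    intro h
    simpa [h] using hwx 1
  have hy0 : (y : K) ≠ 0 := by
    intro h
    simpa [h] using hvy 1
  refine ⟨x / y, v.valuation K, w.valuation K, div_ne_zero hx0 hy0, hint v, hint w, ?_, ?_,
    fun τ hτ ↦ ?_⟩
  · have : v.valuation K (y : K) = 1 := hvy 1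
    rw [map_div₀, this, div_one]
    exact (v.valuation_lt_one_iff_mem x).mpr hx
  · have : w.valuation K (x : K) = 1 := hwx 1
    rw [map_div₀, this, one_div, one_lt_inv₀ (by simpa [zero_lt_iff] using hy0)]
    exact (w.valuation_lt_one_iff_mem y).mpr hy
  · simp only [map_div₀, hvx τ hτ, hvy, hwx, hwy τ hτ, div_one, and_self]

end NumberField.RingOfIntegers

variable {K : Type*} [Field K] [NumberField K]

open WithZero in
/-- A Galois-equivariant exponential on a finite Galois-stable set, which takes integral values only
at zero. -/
theorem NumberField.exists_equivariant_exponential [IsGalois ℚ K] {E : Set K} (hE : E.Finite)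
    (hstab : ∀ (σ : Gal(K/ℚ)), ∀ a ∈ E, σ a ∈ E) :
    ∃ χ : K → K, (∀ a, χ a ≠ 0) ∧ (∀ (σ : Gal(K/ℚ)) a, χ (σ a) = σ (χ a)) ∧
      (∀ a ∈ E, ∀ b ∈ E, a + b ∈ E → χ (a + b) = χ a * χ b) ∧
      ∀ a ∈ E, a ≠ 0 → ¬ IsIntegral ℤ (χ a) := by
  classical
  obtain ⟨φ, hφ⟩ := AddSubgroup.exists_addMonoidHom_closure_ne_zero hE
  obtain ⟨π, v, w, hπ, hv, hw, hvπ, hwπ, hτ⟩ := RingOfIntegers.exists_valuation_galois K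
  let m (a : K) : ℤ := if h : a ∈ E then φ ⟨a, AddSubgroup.subset_closure h⟩ else 0
  have hm (a : K) (h : a ∈ E) : m a = φ ⟨a, AddSubgroup.subset_closure h⟩ := dif_pos h
  have hmadd (a b : K) (ha : a ∈ E) (hb : b ∈ E) (hab : a + b ∈ E) : m (a + b) = m a + m b := by
    rw [hm a ha, hm b hb, hm _ hab, ← map_add]
    rfl
  have hm0 (a : K) (ha : a ∈ E) (ha0 : a ≠ 0) : m a ≠ 0 := by
    rw [hm a ha]
    refine hφ a ha ?_
    rwa [isOfFinAddOrder_iff_eq_zero]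
  let χ (a : K) : K := ∏ τ : Gal(K/ℚ), τ π ^ m (τ⁻¹ a)
  have hval (u : Valuation K ℤᵐ⁰) (hu : ∀ τ : Gal(K/ℚ), τ ≠ 1 → u (τ π) = 1) (a : K) :
      u (χ a) = u π ^ m a := by
    rw [map_prod, Finset.prod_eq_single 1]
    · simp
    · intro τ _ h
      rw [map_zpow₀, hu τ h, one_zpow]
    · simp
  refine ⟨χ, fun a ↦ ?_, fun σ a ↦ ?_, fun a ha b hb hab ↦ ?_, fun a ha ha0 hint ↦ ?_⟩
  · exact Finset.prod_ne_zero_iff.mpr fun τ _ ↦ zpow_ne_zero _ (by simpa using hπ)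
  · simp only [χ, map_prod, map_zpow₀]
    refine (Fintype.prod_equiv (Equiv.mulLeft σ) _ _ fun τ ↦ ?_).symm
    simp [mul_inv_rev, AlgEquiv.mul_apply]
  · simp only [χ, ← Finset.prod_mul_distrib]
    refine Finset.prod_congr rfl fun τ _ ↦ ?_
    rw [map_add, hmadd _ _ (hstab _ a ha) (hstab _ b hb) (by simpa using hstab τ⁻¹ _ hab),
      zpow_add₀ (by simpa using hπ)]
  · rcases (hm0 a ha ha0).lt_or_gt with h | h
    · refine (hv _ hint).not_gt ?_
      rw [hval v fun τ h ↦ (hτ τ h).1]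
      exact one_lt_zpow_of_neg₀ (by simpa [zero_lt_iff] using hπ) hvπ h
    · refine (hw _ hint).not_gt ?_
      rw [hval w fun τ h ↦ (hτ τ h).2]
      exact one_lt_zpow₀ hwπ h

theorem Polynomial.exists_pow_dvd_sub_C_of_equivariant [IsGalois ℚ K] {E : Set K} (hE : E.Finite)
    (hstab : ∀ (σ : Gal(K/ℚ)), ∀ a ∈ E, σ a ∈ E) {χ : K → K}
    (hχ : ∀ (σ : Gal(K/ℚ)) a, χ (σ a) = σ (χ a)) (n : ℕ) :
    ∃ P : ℚ[X], ∀ a ∈ E, (X - C a) ^ n ∣ P.map (algebraMap ℚ K) - C (χ a) := by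
  obtain ⟨P, hP⟩ := Polynomial.exists_pow_dvd_sub_C hE.toFinset χ n
  let c : ℚ := (Fintype.card Gal(K/ℚ) : ℚ)⁻¹
  let S : K[X] := ∑ σ : Gal(K/ℚ), P.map (σ : K →+* K)
  have hS (τ : Gal(K/ℚ)) : S.map (τ : K →+* K) = S := by
    simp only [S, Polynomial.map_sum, Polynomial.map_map]
    exact Fintype.sum_equiv (Equiv.mulLeft τ) _ _ fun σ ↦ rfl
  obtain ⟨R, hR⟩ : ∃ R : ℚ[X], R.map (algebraMap ℚ K) = S := by
    refine (Polynomial.mem_lifts S).mp ((Polynomial.lifts_iff_coeff_lifts S).mpr fun i ↦ ?_)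
    have : S.coeff i ∈ (⊥ : IntermediateField ℚ K) := by
      refine (IsGalois.mem_bot_iff_fixed _).mpr fun τ ↦ ?_
      conv_rhs => rw [← hS τ]
      simp
    exact IntermediateField.mem_bot.mp this
  have hdvd (σ : Gal(K/ℚ)) (a : K) (ha : a ∈ E) :
      (X - C a) ^ n ∣ P.map (σ : K →+* K) - C (χ a) := by
    obtain ⟨b, hb, rfl⟩ : ∃ b ∈ E, σ b = a := ⟨σ⁻¹ a, hstab _ a ha, σ.apply_symm_apply a⟩
    have := Polynomial.map_dvd (σ : K →+* K) (hP b (by simpa using hb))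
    simpa [hχ] using this
  refine ⟨C c * R, fun a ha ↦ ?_⟩
  have hsum : S - C (Fintype.card Gal(K/ℚ) * χ a) =
      ∑ σ : Gal(K/ℚ), (P.map (σ : K →+* K) - C (χ a)) := by
    simp [S, Finset.sum_sub_distrib]
  have h2 : (C c * R).map (algebraMap ℚ K) - C (χ a) =
      C (algebraMap ℚ K c) * (S - C (Fintype.card Gal(K/ℚ) * χ a)) := by
    have hc : algebraMap ℚ K c * Fintype.card Gal(K/ℚ) = 1 := by simp [c]
    rw [Polynomial.map_mul, map_C, hR, mul_sub, ← C_mul, ← mul_assoc, hc, one_mul]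
  rw [h2, hsum]
  exact (Finset.dvd_sum fun σ _ ↦ hdvd σ a ha).mul_left _

end NumberField

/-- For finitely many algebraic numbers closed under conjugation, a rational polynomial realises an
exponential taking integral values only at zero. -/
theorem Polynomial.exists_exponential_on_rootSet {L : Type*} [Field L] [Algebra ℚ L] [IsAlgClosed L]
    (q : ℚ[X]) (n : ℕ) :
    ∃ (P : ℚ[X]) (χ : L → L), ∀ a ∈ q.rootSet L,
      (X - C a) ^ n ∣ P.map (algebraMap ℚ L) - C (χ a) ∧ χ a ≠ 0 ∧
      (a ≠ 0 → ¬ IsIntegral ℤ (χ a)) ∧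
      ∀ b ∈ q.rootSet L, a + b ∈ q.rootSet L → χ (a + b) = χ a * χ b := by
  let K := q.SplittingField
  have : CharZero K := charZero_of_injective_algebraMap (algebraMap ℚ K).injective
  have : NumberField K := { to_charZero := this, to_finiteDimensional := inferInstance }
  have : IsSplittingField ℚ K q := IsSplittingField.splittingField q
  have : Normal ℚ K := Normal.of_isSplittingField q
  have : IsGalois ℚ K := {}
  have hE : (q.rootSet K).Finite := q.rootSet_finite K
  have hstab (σ : Gal(K/ℚ)) (a : K) (ha : a ∈ q.rootSet K) : σ a ∈ q.rootSet K := by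
    rw [mem_rootSet] at ha ⊢
    exact ⟨ha.1, by rw [aeval_algHom_apply, ha.2, map_zero]⟩
  obtain ⟨χ, h0, hχ, hadd, hint⟩ := NumberField.exists_equivariant_exponential hE hstab
  obtain ⟨P, hP⟩ := Polynomial.exists_pow_dvd_sub_C_of_equivariant hE hstab hχ n
  let ι : K →ₐ[ℚ] L := IsAlgClosed.lift
  have hι : Function.Injective ι := ι.injective
  let χ' : L → L := Function.extend ι (ι ∘ χ) 0
  have hχ' (a : K) : χ' (ι a) = ι (χ a) := hι.extend_apply _ _ a
  have himage : ι '' q.rootSet K = q.rootSet L :=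
    (SplittingField.splits q).image_rootSet ι
  refine ⟨P, χ', ?_⟩
  rw [← himage]
  rintro _ ⟨a, ha, rfl⟩
  refine ⟨?_, ?_, fun ha0 h ↦ ?_, ?_⟩
  · have := Polynomial.map_dvd (ι : K →+* L) (hP a ha)
    simpa [hχ', Polynomial.map_map] using this
  · simpa [hχ'] using h0 a
  · rw [hχ'] at h
    exact hint a ha (by rintro rfl; simp at ha0)
      ((isIntegral_algHom_iff (ι : K →+* L).toIntAlgHom hι).mp h)
  · rintro _ ⟨b, hb, rfl⟩ ⟨c, hc, habc⟩
    obtain rfl : c = a + b := hι (by simpa using habc)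
    rw [← map_add, hχ', hχ', hχ', hadd a ha b hb hc, map_mul]

theorem Module.End.baseChange_pow_sub_one {k V : Type*} (B : Type*) [Field k] [AddCommGroup V]
    [Module k V] [Field B] [Algebra k B] (f : End k V) (m : ℕ) :
    (f ^ m - 1).baseChange B = f.baseChange B ^ m - 1 := by
  change End.baseChangeHom k B V (f ^ m - 1) = End.baseChangeHom k B V f ^ m - 1
  rw [map_sub, map_pow, map_one]

section RationalLieAlgebra

variable {𝔫 : Type*} [LieRing 𝔫] [LieAlgebra ℚ 𝔫] [FiniteDimensional ℚ 𝔫]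

theorem hasSpecialGrading_of_aut (A L : Type*) [Field A] [IsAlgClosed A] [Algebra ℚ A] [Field L]
    [IsAlgClosed L] [Algebra ℚ L] {f : End ℚ 𝔫} (hf : ∀ x y, f ⁅x, y⁆ = ⁅f x, f y⁆)
    (hbij : Function.Bijective f)
    (h : ∀ μ : L, (∃ x ∈ (LieAlgebra.center ℚ 𝔫).toSubmodule.baseChange L,
      x ≠ 0 ∧ f.baseChange L x = μ • x) → ¬ IsIntegral ℤ μ) :
    HasSpecialGrading A (A ⊗[ℚ] 𝔫) := by
  have : CharZero A := algebraRat.charZero A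
  refine hasSpecialGrading_of_no_finite_order_eigenvalue (LinearMap.baseChange_lie hf)
    (Module.Flat.lTensor_preserves_injective_linearMap (M := A) f hbij.1) fun x hx μ hxμ hμ ↦ ?_
  obtain ⟨m, hm0, hm⟩ := hμ.exists_pow_eq_one
  have hfx (k : ℕ) : (f.baseChange A ^ k) x = μ ^ k • x := by
    induction k with
    | zero => simp
    | succ k ih => rw [pow_succ', End.mul_apply, ih, map_smul, hxμ, smul_smul, pow_succ]
  refine LinearMap.baseChange_injOn (g := f ^ m - 1) (fun z hz hfz ↦ ?_)
    (LieAlgebra.mem_baseChange_center_iff.mpr hx) ?_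
  swap
  · rw [End.baseChange_pow_sub_one, LinearMap.sub_apply, hfx, hm, one_smul, End.one_apply, sub_self]
  by_contra hz0
  let g := f.baseChange L
  let U := (LieAlgebra.center ℚ 𝔫).toSubmodule.baseChange L ⊓ LinearMap.ker (g ^ m - 1)
  have hU : ∀ w ∈ U, g w ∈ U := by
    rintro w ⟨hw, hw'⟩
    refine ⟨?_, ?_⟩
    · rw [SetLike.mem_coe, LieAlgebra.mem_baseChange_center_iff] at hw ⊢
      intro y
      obtain ⟨y, rfl⟩ : ∃ y', g y' = y := LinearMap.lTensor_surjective L hbij.2 y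
      rw [← LinearMap.baseChange_lie hf, hw y, map_zero]
    · have hcomm : Commute (g ^ m - 1) g :=
        ((Commute.refl g).pow_left m).sub_left (Commute.one_left g)
      simp only [SetLike.mem_coe, LinearMap.mem_ker] at hw' ⊢
      rw [← End.mul_apply, hcomm.eq, End.mul_apply, hw', map_zero]
  have hzU : (1 : L) ⊗ₜ[ℚ] z ∈ U := by
    refine ⟨Submodule.tmul_mem_baseChange_of_mem 1 hz, ?_⟩
    simp only [SetLike.mem_coe, LinearMap.mem_ker]
    rw [← End.baseChange_pow_sub_one, LinearMap.baseChange_tmul, hfz, tmul_zero]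
  have hz1 : (1 : L) ⊗ₜ[ℚ] z ≠ 0 := fun h0 ↦ hz0 <|
    Module.FaithfullyFlat.tensorProduct_mk_injective 𝔫 (h0.trans (map_zero _).symm)
  obtain ⟨ν, y, ⟨hy, hy'⟩, hν⟩ := End.exists_hasEigenvector_mem hU hzU hz1
  refine h ν ⟨y, hy, hν.2, hν.apply_eq_smul⟩ ?_
  have hνm : ν ^ m = 1 := by
    have h1 := hν.pow_apply m
    simp only [SetLike.mem_coe, LinearMap.mem_ker, LinearMap.sub_apply, End.one_apply, h1] at hy'
    have h2 : (ν ^ m - 1) • y = 0 := by rw [sub_smul, one_smul, hy']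
    exact sub_eq_zero.mp ((smul_eq_zero.mp h2).resolve_right hν.2)
  exact IsIntegral.of_pow hm0 (hνm ▸ isIntegral_one)

theorem exists_aut_of_derivation (L : Type*) [Field L] [IsAlgClosed L] [Algebra ℚ L]
    {δ : End ℚ 𝔫} (hδ : ∀ x y, δ ⁅x, y⁆ = ⁅δ x, y⁆ + ⁅x, δ y⁆)
    (hz : ∀ z ∈ LieAlgebra.center ℚ 𝔫, δ z = 0 → z = 0) :
    ∃ f : End ℚ 𝔫, (∀ x y, f ⁅x, y⁆ = ⁅f x, f y⁆) ∧ Function.Bijective f ∧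
      ∀ μ : L, (∃ x ∈ (LieAlgebra.center ℚ 𝔫).toSubmodule.baseChange L,
        x ≠ 0 ∧ f.baseChange L x = μ • x) → ¬ IsIntegral ℤ μ := by
  obtain ⟨P, χ, hχ⟩ := Polynomial.exists_exponential_on_rootSet (L := L) δ.charpoly (finrank ℚ 𝔫)
  let D : End L (L ⊗[ℚ] 𝔫) := δ.baseChange L
  have hD : ∀ x y, D ⁅x, y⁆ = ⁅D x, y⁆ + ⁅x, D y⁆ := LinearMap.baseChange_leibniz hδ
  let f := aeval δ P
  let F : End L (L ⊗[ℚ] 𝔫) := f.baseChange L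
  have hF : F = aeval D (P.map (algebraMap ℚ L)) := by
    rw [aeval_map_algebraMap]
    exact (aeval_algHom_apply (End.baseChangeHom ℚ L 𝔫) δ P).symm
  have hroot (α : L) (hα : D.HasEigenvalue α) : α ∈ δ.charpoly.rootSet L := by
    rw [mem_rootSet_of_ne δ.charpoly_monic.ne_zero, ← eval_map_algebraMap,
      ← LinearMap.charpoly_baseChange]
    exact End.hasEigenvalue_iff_isRoot_charpoly D α |>.mp hα
  have hFW (α : L) (x : L ⊗[ℚ] 𝔫) (hx : x ∈ D.maxGenEigenspace α) : F x = χ α • x := by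
    by_cases hx0 : x = 0
    · simp [hx0]
    rw [hF]
    refine End.aeval_apply_of_mem_maxGenEigenspace ?_ hx
    rw [finrank_baseChange]
    exact (hχ α (hroot α (End.hasEigenvalue_of_mem_maxGenEigenspace hx hx0))).1
  have hcomm : Commute D F := by
    rw [hF]
    simpa using (Commute.all X (P.map (algebraMap ℚ L))).map (aeval D)
  have hFlie : ∀ x y, F ⁅x, y⁆ = ⁅F x, F y⁆ := by
    let B : L ⊗[ℚ] 𝔫 →ₗ[L] L ⊗[ℚ] 𝔫 →ₗ[L] L ⊗[ℚ] 𝔫 :=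
      (LieModule.toEnd L (L ⊗[ℚ] 𝔫) (L ⊗[ℚ] 𝔫) : L ⊗[ℚ] 𝔫 →ₗ[L] End L (L ⊗[ℚ] 𝔫))
    suffices B.compr₂ F = B.compl₁₂ F F from fun x y ↦ LinearMap.congr_fun₂ this x y
    refine LinearMap.ext_maxGenEigenspace₂ D fun α β x hx y hy hα hβ ↦ ?_
    change F ⁅x, y⁆ = ⁅F x, F y⁆
    by_cases h0 : ⁅x, y⁆ = 0
    · simp [hFW α x hx, hFW β y hy, h0]
    have hxy := lie_mem_maxGenEigenspace_add hD hx hy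
    have hadd := (hχ α (hroot α hα)).2.2.2 β (hroot β hβ)
      (hroot _ (End.hasEigenvalue_of_mem_maxGenEigenspace hxy h0))
    rw [hFW α x hx, hFW β y hy, hFW _ _ hxy, hadd, smul_lie, lie_smul, smul_smul]
  have hinj1 : Function.Injective fun x : 𝔫 ↦ (1 : L) ⊗ₜ[ℚ] x :=
    Module.FaithfullyFlat.tensorProduct_mk_injective 𝔫
  have hf1 (x : 𝔫) : F (1 ⊗ₜ x) = 1 ⊗ₜ f x := LinearMap.baseChange_tmul ..
  have hflie (x y : 𝔫) : f ⁅x, y⁆ = ⁅f x, f y⁆ := hinj1 (by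
    have := hFlie (1 ⊗ₜ x) (1 ⊗ₜ y)
    simpa [hf1] using this)
  have eigen (U : Submodule L (L ⊗[ℚ] 𝔫)) (hU : ∀ x ∈ U, D x ∈ U) (x) (hxU : x ∈ U) (hx : x ≠ 0) :
      ∃ α y, y ∈ U ∧ D.HasEigenvector α y ∧ F y = χ α • y ∧ α ∈ δ.charpoly.rootSet L := by
    obtain ⟨α, y, hy, hα⟩ := End.exists_hasEigenvector_mem hU hxU hx
    exact ⟨α, y, hy, hα, hFW α y (End.eigenspace_le_maxGenEigenspace hα.1),
      hroot α (End.hasEigenvalue_of_hasEigenvector hα)⟩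
  have hfinj : Function.Injective f := by
    rw [injective_iff_map_eq_zero]
    intro x hx
    by_contra hx0
    obtain ⟨α, y, hy, hα, hFy, hαr⟩ := eigen (LinearMap.ker F) (fun y hy ↦ by
      rw [LinearMap.mem_ker] at hy ⊢
      rw [← End.mul_apply, ← hcomm.eq, End.mul_apply, hy, map_zero]) (1 ⊗ₜ x)
      (by rw [LinearMap.mem_ker, hf1, hx, tmul_zero])
      (fun h ↦ hx0 (hinj1 (by simpa using h)))
    rw [LinearMap.mem_ker.mp hy, eq_comm, smul_eq_zero] at hFy
    exact hFy.elim (hχ α hαr).2.1 hα.2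
  refine ⟨f, hflie, ⟨hfinj, LinearMap.injective_iff_surjective.mp hfinj⟩, ?_⟩
  rintro μ ⟨x, hx, hx0, hxμ⟩
  obtain ⟨α, y, ⟨hy, hyμ⟩, hα, hFy, hαr⟩ := eigen
    ((LieAlgebra.center ℚ 𝔫).toSubmodule.baseChange L ⊓ F.eigenspace μ) (fun y ⟨hy, hyμ⟩ ↦ by
      simp only [SetLike.mem_coe, End.mem_eigenspace_iff, LieAlgebra.mem_baseChange_center_iff,
        Submodule.mem_inf] at hy hyμ ⊢
      refine ⟨fun w ↦ ?_, ?_⟩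
      · have := hD w y
        rwa [hy w, hy (D w), map_zero, zero_add, eq_comm] at this
      · rw [← End.mul_apply, ← hcomm.eq, End.mul_apply, hyμ, map_smul]) x
    ⟨hx, End.mem_eigenspace_iff.mpr hxμ⟩ hx0
  rw [← End.mem_eigenspace_iff] at hFy
  have hμ : μ = χ α := by
    have h1 := End.mem_eigenspace_iff.mp hFy
    rw [End.mem_eigenspace_iff.mp hyμ] at h1
    exact smul_left_injective L hα.2 h1
  rw [hμ]
  refine (hχ α hαr).2.2.1 ?_
  rintro rfl
  exact hα.2 (LinearMap.baseChange_injOn hz hy (by simpa using hα.apply_eq_smul))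

end RationalLieAlgebra

/-- A finite-dimensional Lie algebra `𝔫` over `ℚ` (with center `𝔷`) is
such that `ℂ ⊗ 𝔫` admits a special grading iff there is a Lie algebra automorphism `f`
of `𝔫` such that no eigenvalue of the restriction of `f` to `𝔷` (i.e. no `μ ∈ ℚ̄`
admitting an eigenvector of `f̄` inside `ℚ̄ ⊗ 𝔷`) is an algebraic integer. -/
theorem hasSpecialGrading_iff_exists_aut_no_integral_eigenvalue_on_center
    {𝔫 : Type*} [LieRing 𝔫] [LieAlgebra ℚ 𝔫] [FiniteDimensional ℚ 𝔫] :
    HasSpecialGrading ℂ (ℂ ⊗[ℚ] 𝔫) ↔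
      ∃ f : 𝔫 ≃ₗ⁅ℚ⁆ 𝔫, ∀ μ : AlgebraicClosure ℚ,
        (∃ x ∈ Submodule.baseChange (AlgebraicClosure ℚ)
              (LieAlgebra.center ℚ 𝔫).toSubmodule,
          x ≠ 0 ∧
            LinearMap.baseChange (AlgebraicClosure ℚ) f.toLieHom.toLinearMap x = μ • x) →
        ¬ IsIntegral ℤ μ := by
  constructor
  · rintro ⟨p, hp, hp0⟩
    obtain ⟨D, hD, hD0⟩ := hp.exists_derivation
    obtain ⟨δ, hδ, hδz⟩ := LieAlgebra.exists_derivation_injOn_center hD fun x hx hDx ↦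
      (Submodule.mem_bot ℂ).mp (hp0 ▸ ⟨hD0 x hDx, hx⟩)
    obtain ⟨f, hf, hbij, h⟩ := exists_aut_of_derivation (AlgebraicClosure ℚ) hδ hδz
    let φ : 𝔫 →ₗ⁅ℚ⁆ 𝔫 := { f with map_lie' := fun {x y} ↦ hf x y }
    exact ⟨LieEquiv.ofBijective φ hbij, h⟩
  · rintro ⟨f, hf⟩
    exact hasSpecialGrading_of_aut ℂ (AlgebraicClosure ℚ) (f := f.toLieHom.toLinearMap)
      (fun x y ↦ f.toLieHom.map_lie x y) f.bijective hf
end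

section
/- Let 𝔫 be a finite-dimensional Lie algebra over ℚ with center 𝔷. The following assertions are equivalent: (i) 𝔫 admits a non-negative special grading over ℚ; (ii) ℂ ⊗_ℚ 𝔫 admits a non-negative special grading; (iii) there exists a Lie algebra automorphism f of 𝔫 such that no eigenvalue of the restriction of f to 𝔷 is an algebraic integer and every eigenvalue of f⁻¹ is an algebraic integer. -/
open TensorProduct

open Polynomial

/-- The polynomial `∏_{k = 1}^m (X - k)`. -/
noncomputable def weightPoly (m : ℕ) : ℤ[X] :=
  ∏ k ∈ Finset.range m, (X - C ((k : ℤ) + 1))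

theorem X_mul_weightPoly (m : ℕ) :
    X * weightPoly m = ∏ k ∈ Finset.range (m + 1), (X - C (k : ℤ)) := by
  rw [Finset.prod_range_succ', mul_comm, weightPoly]
  simp

section CharZero

variable {K : Type*} [CommRing K] [IsDomain K] [CharZero K]

theorem aeval_weightPoly_eq_zero_iff {m : ℕ} {μ : K} :
    aeval μ (weightPoly m) = 0 ↔ ∃ k : ℕ, 1 ≤ k ∧ k ≤ m ∧ μ = k := by
  simp only [weightPoly, map_prod, Finset.prod_eq_zero_iff, Finset.mem_range, map_sub, aeval_X,
    aeval_C, sub_eq_zero]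
  constructor
  · rintro ⟨k, hk, rfl⟩
    exact ⟨k + 1, by lia, by lia, by simp⟩
  · rintro ⟨k, hk, hkm, rfl⟩
    obtain ⟨k, rfl⟩ := Nat.exists_eq_add_of_le' hk
    exact ⟨k, by lia, by simp⟩

theorem aeval_X_mul_weightPoly_eq_zero_iff {m : ℕ} {μ : K} :
    aeval μ (X * weightPoly m) = 0 ↔ ∃ k : ℕ, k ≤ m ∧ μ = k := by
  rw [map_mul, mul_eq_zero, aeval_weightPoly_eq_zero_iff, aeval_X]
  constructor
  · rintro (rfl | ⟨k, -, hk, rfl⟩)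
    · exact ⟨0, by simp⟩
    · exact ⟨k, hk, rfl⟩
  · rintro ⟨k, hk, rfl⟩
    rcases k.eq_zero_or_pos with rfl | h
    · simp
    · exact Or.inr ⟨k, h, hk, rfl⟩

end CharZero

section Intertwine

variable {K V K' V' : Type*} [CommRing K] [AddCommGroup V] [Module K V]
  [CommRing K'] [AddCommGroup V'] [Module K' V']

theorem map_aeval_int_of_intertwine {D : Module.End K V} {D' : Module.End K' V'} (j : V →+ V')
    (h : ∀ x, j (D x) = D' (j x)) (q : ℤ[X]) (x : V) :
    j (aeval D q x) = aeval D' q (j x) := by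
  induction q using Polynomial.induction_on' generalizing x with
  | add p q hp hq => simp [hp, hq]
  | monomial n a =>
    have hn : ∀ x, j ((D ^ n) x) = (D' ^ n) (j x) := by
      induction n with
      | zero => simp
      | succ n ih => intro x; rw [pow_succ, pow_succ, Module.End.mul_apply, ih, h,
          Module.End.mul_apply]
    simp [aeval_monomial, hn, ← zsmul_eq_mul]

end Intertwine

section Eigen

variable {K V : Type*} [CommRing K] [AddCommGroup V] [Module K V]

theorem aeval_int_apply_of_eigen {D : Module.End K V} {μ : K} {x : V} (h : D x = μ • x)
    (q : ℤ[X]) : aeval D q x = aeval μ q • x := by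
  induction q using Polynomial.induction_on' with
  | add p q hp hq => simp [hp, hq, add_smul]
  | monomial n a =>
    have hn : (D ^ n) x = μ ^ n • x := by
      induction n with
      | zero => simp
      | succ n ih => rw [pow_succ', Module.End.mul_apply, ih, map_smul, h, smul_smul, pow_succ]
    simp [aeval_monomial, hn, ← zsmul_eq_mul]

end Eigen

/-- A diagonalizable derivation `D` with weights in `{0, …, m}`, such that the elements of `C` only
have components of positive weights. -/
structure IsWeightDerivation {K V : Type*} [CommRing K] [LieRing V] [LieAlgebra K V]
    (D : Module.End K V) (m : ℕ) (C : Set V) : Prop where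
  leibniz : ∀ x y, D ⁅x, y⁆ = ⁅D x, y⁆ + ⁅x, D y⁆
  aeval_eq_zero : aeval D (X * weightPoly m) = 0
  aeval_apply_eq_zero : ∀ z ∈ C, aeval D (weightPoly m) z = 0

section Transfer

variable {K V K' V' : Type*} [CommRing K] [LieRing V] [LieAlgebra K V]
  [CommRing K'] [LieRing V'] [LieAlgebra K' V']

theorem IsWeightDerivation.of_injective {D : Module.End K V} {D' : Module.End K' V'} {m : ℕ}
    {C : Set V} {C' : Set V'} (h : IsWeightDerivation D' m C') (j : V →+ V')
    (hlie : ∀ x y, j ⁅x, y⁆ = ⁅j x, j y⁆) (hj : Function.Injective j)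
    (hD : ∀ x, j (D x) = D' (j x)) (hC : ∀ z ∈ C, j z ∈ C') : IsWeightDerivation D m C where
  leibniz x y := hj (by simp [hlie, hD, h.leibniz])
  aeval_eq_zero := by
    ext x
    apply hj
    rw [map_aeval_int_of_intertwine j hD, h.aeval_eq_zero]
    simp
  aeval_apply_eq_zero z hz := by
    apply hj
    rw [map_aeval_int_of_intertwine j hD, h.aeval_apply_eq_zero _ (hC z hz), map_zero]

theorem IsWeightDerivation.of_surjective {D : Module.End K V} {D' : Module.End K' V'} {m : ℕ}
    {C : Set V} {C' : Set V'} (h : IsWeightDerivation D m C) (j : V →+ V')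
    (hlie : ∀ x y, j ⁅x, y⁆ = ⁅j x, j y⁆) (hj : Function.Surjective j)
    (hD : ∀ x, j (D x) = D' (j x)) (hC : C' ⊆ j '' C) : IsWeightDerivation D' m C' where
  leibniz x y := by
    obtain ⟨x, rfl⟩ := hj x
    obtain ⟨y, rfl⟩ := hj y
    simp [← hlie, ← hD, h.leibniz]
  aeval_eq_zero := by
    ext x
    obtain ⟨x, rfl⟩ := hj x
    rw [← map_aeval_int_of_intertwine j hD, h.aeval_eq_zero]
    simp
  aeval_apply_eq_zero z hz := by
    obtain ⟨w, hw, rfl⟩ := hC hz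
    rw [← map_aeval_int_of_intertwine j hD, h.aeval_apply_eq_zero _ hw, map_zero]

end Transfer

theorem leibniz_of_iSup_eq_top {K V ι : Type*} [CommRing K] [LieRing V] [LieAlgebra K V]
    (D : Module.End K V) (p : ι → Submodule K V)
    (hp : ⨆ i, p i = ⊤)
    (h : ∀ i j, ∀ x ∈ p i, ∀ y ∈ p j, D ⁅x, y⁆ = ⁅D x, y⁆ + ⁅x, D y⁆) (x y : V) :
    D ⁅x, y⁆ = ⁅D x, y⁆ + ⁅x, D y⁆ := by
  have hx : x ∈ ⨆ i, p i := hp ▸ Submodule.mem_top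
  have hy : y ∈ ⨆ i, p i := hp ▸ Submodule.mem_top
  refine Submodule.iSup_induction p (motive := fun x => D ⁅x, y⁆ = ⁅D x, y⁆ + ⁅x, D y⁆) hx
    (fun i x hx => ?_) (by simp)
    fun a b ha hb => by simp only [add_lie, map_add, ha, hb]; abel
  exact Submodule.iSup_induction p (motive := fun y => D ⁅x, y⁆ = ⁅D x, y⁆ + ⁅x, D y⁆) hy
    (fun j y hy => h i j x hx y hy) (by simp)
    fun a b ha hb => by simp only [lie_add, map_add, ha, hb]; abel

section Grading

variable {K V : Type*} [Field K] [CharZero K] [LieRing V] [LieAlgebra K V]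

theorem ker_aeval_prod_le_iSup_eigenspace (D : Module.End K V) (n : ℕ) :
    (aeval D (∏ k ∈ Finset.range n, (X - C (k : K)))).ker ≤
      ⨆ k : ℕ, D.eigenspace (k : K) := by
  induction n with
  | zero => simp [Module.End.one_eq_id]
  | succ n ih =>
    rw [Finset.prod_range_succ, ← sup_ker_aeval_eq_ker_aeval_mul_of_coprime]
    · refine sup_le ih ?_
      refine le_trans (le_of_eq ?_) (le_iSup _ n)
      rw [Module.End.eigenspace_def]
      congr 1
      ext x
      simp [Nat.cast_smul_eq_nsmul]
    · refine IsCoprime.prod_left fun k hk => ?_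
      refine Polynomial.isCoprime_X_sub_C_of_isUnit_sub ?_
      have : k ≠ n := (Finset.mem_range.1 hk).ne
      rw [isUnit_iff_ne_zero, sub_ne_zero]
      exact_mod_cast this

theorem IsWeightDerivation.iSup_eigenspace {D : Module.End K V} {m : ℕ} {C : Set V}
    (h : IsWeightDerivation D m C) : ⨆ k : ℕ, D.eigenspace (k : K) = ⊤ := by
  rw [eq_top_iff]
  refine le_trans (le_of_eq ?_) (ker_aeval_prod_le_iSup_eigenspace D (m + 1))
  have h2 : (∏ k ∈ Finset.range (m + 1), (Polynomial.X - Polynomial.C (k : K))) =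
      (X * weightPoly m).map (algebraMap ℤ K) := by
    rw [X_mul_weightPoly, Polynomial.map_prod]
    simp
  rw [h2, aeval_map_algebraMap, h.aeval_eq_zero, LinearMap.ker_zero]

theorem IsWeightDerivation.le_of_eigen {D : Module.End K V} {m : ℕ} {C : Set V}
    (h : IsWeightDerivation D m C) {μ : K} {x : V} (hx : D x = μ • x) (hx0 : x ≠ 0) :
    ∃ k : ℕ, k ≤ m ∧ μ = k := by
  rw [← aeval_X_mul_weightPoly_eq_zero_iff]
  have := aeval_int_apply_of_eigen hx (X * weightPoly m)
  rw [h.aeval_eq_zero, LinearMap.zero_apply] at this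
  exact (smul_eq_zero.1 this.symm).resolve_right hx0

theorem IsWeightDerivation.hasNonnegSpecialGrading {D : Module.End K V} {m : ℕ}
    (h : IsWeightDerivation D m (LieAlgebra.center K V : Set V)) :
    HasNonnegSpecialGrading K V := by
  refine ⟨fun k => D.eigenspace (k : K), ⟨?_, ?_⟩, ?_, ?_⟩
  · rw [DirectSum.isInternal_submodule_iff_iSupIndep_and_iSup_eq_top]
    refine ⟨D.eigenspaces_iSupIndep.comp Int.cast_injective, ?_⟩
    rw [eq_top_iff, ← h.iSup_eigenspace]
    exact iSup_le fun k => le_iSup_of_le (k : ℤ) (by simp)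
  · intro i j x hx y hy
    simp only [Module.End.mem_eigenspace_iff] at hx hy ⊢
    rw [h.leibniz, hx, hy, smul_lie, lie_smul, ← add_smul]
    simp
  · intro k hk
    rw [eq_bot_iff]
    intro x hx
    rw [Module.End.mem_eigenspace_iff] at hx
    by_contra hx0
    obtain ⟨l, -, hl⟩ := h.le_of_eigen hx hx0
    have : k = l := by exact_mod_cast hl
    lia
  · rw [eq_bot_iff]
    rintro x ⟨hx, hxc⟩
    have hx : D x = (0 : K) • x := by simpa using hx
    have h1 := aeval_int_apply_of_eigen hx (weightPoly m)
    rw [h.aeval_apply_eq_zero x hxc] at h1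
    refine (smul_eq_zero.1 h1.symm).resolve_left fun h0 => ?_
    obtain ⟨k, hk, -, hk0⟩ := aeval_weightPoly_eq_zero_iff.1 h0
    have : k = 0 := by exact_mod_cast hk0.symm
    lia

theorem HasNonnegSpecialGrading.exists_isWeightDerivation [FiniteDimensional K V]
    (h : HasNonnegSpecialGrading K V) :
    ∃ (D : Module.End K V) (m : ℕ),
      IsWeightDerivation D m (LieAlgebra.center K V : Set V) := by
  obtain ⟨p, ⟨hint, hlie⟩, hneg, hspec⟩ := h
  have hind := hint.submodule_iSupIndep
  have htop := hint.submodule_iSup_eq_top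
  let e := LinearEquiv.ofBijective (DirectSum.coeLinearMap p) hint
  let D : Module.End K V := DirectSum.toModule K ℤ V (fun k => (k : K) • (p k).subtype) ∘ₗ
    e.symm.toLinearMap
  have hD : ∀ k, ∀ x ∈ p k, D x = (k : K) • x := by
    intro k x hx
    have : e.symm x = DirectSum.lof K ℤ (fun k => p k) k ⟨x, hx⟩ := by
      rw [LinearEquiv.symm_apply_eq]
      exact (DirectSum.coeLinearMap_lof p k ⟨x, hx⟩).symm
    simp [D, this]
  obtain ⟨m, hm⟩ : ∃ m : ℕ, ∀ k, p k ≠ ⊥ → k ≤ m := by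
    obtain ⟨m, hm⟩ := (WellFoundedGT.finite_ne_bot_of_iSupIndep hind).bddAbove
    exact ⟨m.toNat, fun k hk => (hm hk).trans (Int.self_le_toNat m)⟩
  have hleib := leibniz_of_iSup_eq_top D p htop fun i j x hx y hy => by
    rw [hD _ _ (hlie i j x hx y hy), hD i x hx, hD j y hy, smul_lie, lie_smul, ← add_smul]
    simp
  have hnat : ∀ k, ∀ x ∈ p k, x ≠ 0 → ∃ l : ℕ, l ≤ m ∧ k = l := by
    intro k x hx hx0
    have hk : p k ≠ ⊥ := fun hb => hx0 (by simpa [hb] using hx)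
    have h0 : 0 ≤ k := by
      by_contra hk0
      exact hk (hneg k (by lia))
    exact ⟨k.toNat, by have := hm k hk; lia, by lia⟩
  have hzero : ∀ x, aeval D (weightPoly m) x ∈ p 0 := by
    intro x
    have hx : x ∈ ⨆ i, p i := htop ▸ Submodule.mem_top
    refine Submodule.iSup_induction p (motive := fun x => aeval D (weightPoly m) x ∈ p 0) hx
      (fun k x hx => ?_) (by simp) fun a b ha hb => by rw [map_add]; exact add_mem ha hb
    by_cases hx0 : x = 0
    · simp [hx0]
    obtain ⟨l, hl, rfl⟩ := hnat k x hx hx0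
    rw [aeval_int_apply_of_eigen (hD _ x hx)]
    rcases l.eq_zero_or_pos with rfl | hpos
    · exact Submodule.smul_mem _ _ hx
    · rw [aeval_weightPoly_eq_zero_iff.2 ⟨l, hpos, hl, by simp⟩]
      simp
  refine ⟨D, m, hleib, ?_, ?_⟩
  · ext x
    simp only [map_mul, aeval_X, Module.End.mul_apply, LinearMap.zero_apply]
    simpa using hD 0 _ (hzero x)
  · intro z hz
    have hcen : ∀ q : ℤ[X], ∀ z ∈ LieAlgebra.center K V, aeval D q z ∈ LieAlgebra.center K V := by
      have hDc : ∀ z ∈ LieAlgebra.center K V, D z ∈ LieAlgebra.center K V := by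
        intro z hz
        rw [LieModule.mem_maxTrivSubmodule] at hz ⊢
        intro x
        simpa [hz] using (hleib x z).symm
      intro q z hz
      induction q using Polynomial.induction_on' with
      | add p q hp hq => simpa using add_mem hp hq
      | monomial n a =>
        have hn : (D ^ n) z ∈ LieAlgebra.center K V := by
          induction n with
          | zero => simpa using hz
          | succ n ih => rw [pow_succ', Module.End.mul_apply]; exact hDc _ ih
        simpa [aeval_monomial, ← zsmul_eq_mul] using zsmul_mem hn a
    have hmem : aeval D (weightPoly m) z ∈ p 0 ⊓ (LieAlgebra.center K V).toSubmodule :=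
      ⟨hzero z, hcen _ z hz⟩
    simpa [hspec] using hmem

end Grading

section Slice

variable {K A V : Type*} [CommRing K] [CommRing A] [Algebra K A]

/-- The map `A ⊗ V → V` induced by a linear form on `A`. -/
noncomputable def tensorSlice [AddCommGroup V] [Module K V] (l : A →ₗ[K] K) :
    A ⊗[K] V →ₗ[K] V :=
  (TensorProduct.lid K V).toLinearMap ∘ₗ l.rTensor V

@[simp]
theorem tensorSlice_tmul [AddCommGroup V] [Module K V] (l : A →ₗ[K] K) (a : A) (x : V) :
    tensorSlice l (a ⊗ₜ[K] x) = l a • x := by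
  simp [tensorSlice]

theorem eq_zero_of_tensorSlice [AddCommGroup V] [Module K V] [Module.Free K A] {w : A ⊗[K] V}
    (h : ∀ l : A →ₗ[K] K, tensorSlice l w = 0) : w = 0 := by
  let b := Module.Free.chooseBasis K A
  have hb : ∀ i w, TensorProduct.equivFinsuppOfBasisLeft b w i =
      tensorSlice (V := V) (b.coord i) w := by
    intro i w
    induction w using TensorProduct.induction_on with
    | zero => simp
    | tmul a x => simp
    | add u v hu hv => simp [hu, hv]
  apply (TensorProduct.equivFinsuppOfBasisLeft (N := V) b).injective
  ext i
  simp [hb, h]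

theorem map_tensorSlice [AddCommGroup V] [Module K V] (l : A →ₗ[K] K) (D : Module.End K V)
    (w : A ⊗[K] V) : D (tensorSlice l w) = tensorSlice l (D.baseChange A w) := by
  induction w using TensorProduct.induction_on with
  | zero => simp
  | tmul a x => simp
  | add u v hu hv => simp [hu, hv]

variable [LieRing V] [LieAlgebra K V]

theorem lie_tensorSlice_left (l : A →ₗ[K] K) (w : A ⊗[K] V) (y : V) :
    ⁅tensorSlice l w, y⁆ = tensorSlice l ⁅w, (1 : A) ⊗ₜ[K] y⁆ := by
  induction w using TensorProduct.induction_on with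
  | zero => simp
  | tmul a x => simp [LieAlgebra.ExtendScalars.bracket_tmul]
  | add u v hu hv => simp [hu, hv, add_lie]

theorem lie_tensorSlice_right (l : A →ₗ[K] K) (w : A ⊗[K] V) (y : V) :
    ⁅y, tensorSlice l w⁆ = tensorSlice l ⁅(1 : A) ⊗ₜ[K] y, w⁆ := by
  rw [← lie_skew, lie_tensorSlice_left, ← map_neg, lie_skew]

theorem tensorSlice_mem_center (l : A →ₗ[K] K) {w : A ⊗[K] V}
    (hw : w ∈ LieAlgebra.center A (A ⊗[K] V)) : tensorSlice l w ∈ LieAlgebra.center K V := by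
  rw [LieModule.mem_maxTrivSubmodule] at hw ⊢
  intro y
  rw [lie_tensorSlice_right, hw, map_zero]

theorem one_tmul_mem_center {z : V} (hz : z ∈ LieAlgebra.center K V) :
    (1 : A) ⊗ₜ[K] z ∈ LieAlgebra.center A (A ⊗[K] V) := by
  rw [LieModule.mem_maxTrivSubmodule] at hz ⊢
  intro w
  induction w using TensorProduct.induction_on with
  | zero => simp
  | tmul a x => simp [LieAlgebra.ExtendScalars.bracket_tmul, hz]
  | add u v hu hv => rw [add_lie, hu, hv, add_zero]

theorem leibniz_baseChange {D : Module.End K V} (h : ∀ x y, D ⁅x, y⁆ = ⁅D x, y⁆ + ⁅x, D y⁆)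
    (u v : A ⊗[K] V) :
    D.baseChange A ⁅u, v⁆ = ⁅D.baseChange A u, v⁆ + ⁅u, D.baseChange A v⁆ := by
  induction u using TensorProduct.induction_on with
  | zero => simp
  | tmul a x =>
    induction v using TensorProduct.induction_on with
    | zero => simp
    | tmul b y => simp [LieAlgebra.ExtendScalars.bracket_tmul, h, TensorProduct.tmul_add]
    | add u v hu hv => simp only [lie_add, map_add, hu, hv]; abel
  | add u v hu hv => simp only [add_lie, map_add, hu, hv]; abel

theorem IsWeightDerivation.baseChange [Module.Free K A] {D : Module.End K V} {m : ℕ}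
    (h : IsWeightDerivation D m (LieAlgebra.center K V : Set V)) :
    IsWeightDerivation (D.baseChange A) m (LieAlgebra.center A (A ⊗[K] V) : Set (A ⊗[K] V)) where
  leibniz := leibniz_baseChange h.leibniz
  aeval_eq_zero := by
    ext x
    refine eq_zero_of_tensorSlice fun l => ?_
    have := map_aeval_int_of_intertwine (D := D.baseChange A) (D' := D)
      (tensorSlice (V := V) l).toAddMonoidHom (fun x => (map_tensorSlice l D x).symm)
      (X * weightPoly m) (1 ⊗ₜ x)
    rw [h.aeval_eq_zero] at this
    exact this
  aeval_apply_eq_zero z hz := by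
    refine eq_zero_of_tensorSlice fun l => ?_
    have := map_aeval_int_of_intertwine (D := D.baseChange A) (D' := D)
      (tensorSlice (V := V) l).toAddMonoidHom (fun x => (map_tensorSlice l D x).symm)
      (weightPoly m) z
    exact this.trans (h.aeval_apply_eq_zero _ (tensorSlice_mem_center l hz))

end Slice

section Automorphism

variable {V : Type*} [LieRing V] [LieAlgebra ℚ V] {D : Module.End ℚ V} {m : ℕ} {S : Set V}

theorem IsWeightDerivation.induction (h : IsWeightDerivation D m S) {motive : V → Prop}
    (mem : ∀ k : ℕ, k ≤ m → ∀ x, D x = (k : ℚ) • x → motive x) (zero : motive 0)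
    (add : ∀ x y, motive x → motive y → motive (x + y)) (x : V) : motive x := by
  have hx : x ∈ ⨆ k : ℕ, D.eigenspace (k : ℚ) := h.iSup_eigenspace ▸ Submodule.mem_top
  refine Submodule.iSup_induction _ (motive := motive) hx (fun k x hx => ?_) zero add
  rw [Module.End.mem_eigenspace_iff] at hx
  by_cases hx0 : x = 0
  · exact hx0 ▸ zero
  obtain ⟨l, hl, hkl⟩ := h.le_of_eigen hx hx0
  exact mem k (by have : k = l := by exact_mod_cast hkl
                  lia) x hx

/-- The operator acting as `r ^ k` on the weight `k` eigenspace of `D`, for `k ≤ m`. -/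
noncomputable def weightScaling (D : Module.End ℚ V) (m : ℕ) (r : ℚ) : Module.End ℚ V :=
  aeval D (Lagrange.interpolate (Finset.range (m + 1)) (fun k : ℕ => (k : ℚ)) fun k => r ^ k)

theorem aeval_rat_apply_of_eigen {D : Module.End ℚ V} {μ : ℚ} {x : V} (h : D x = μ • x)
    (q : ℚ[X]) : aeval D q x = q.eval μ • x := by
  by_cases hx : x = 0
  · simp [hx]
  · exact Module.End.aeval_apply_of_hasEigenvector
      ⟨Module.End.mem_eigenspace_iff.2 h, hx⟩

theorem weightScaling_apply {k : ℕ} (hk : k ≤ m) {x : V} (hx : D x = (k : ℚ) • x) (r : ℚ) :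
    weightScaling D m r x = r ^ k • x := by
  rw [weightScaling, aeval_rat_apply_of_eigen hx,
    Lagrange.eval_interpolate_at_node (v := fun k : ℕ => (k : ℚ)) (fun k => r ^ k)
      Nat.cast_injective.injOn (Finset.mem_range.2 (by lia))]

theorem IsWeightDerivation.weightScaling_lie (h : IsWeightDerivation D m S) (r : ℚ) (x y : V) :
    weightScaling D m r ⁅x, y⁆ = ⁅weightScaling D m r x, weightScaling D m r y⁆ := by
  induction x using h.induction with
  | zero => simp
  | add u v hu hv => simp [hu, hv]
  | mem k hk x hx =>
    induction y using h.induction with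
    | zero => simp
    | add u v hu hv => simp [hu, hv]
    | mem l hl y hy =>
      have hxy : D ⁅x, y⁆ = ((k + l : ℕ) : ℚ) • ⁅x, y⁆ := by
        rw [h.leibniz, hx, hy, smul_lie, lie_smul, ← add_smul]
        simp
      rw [weightScaling_apply hk hx, weightScaling_apply hl hy, smul_lie, lie_smul, smul_smul,
        ← pow_add]
      by_cases h0 : ⁅x, y⁆ = 0
      · simp [h0]
      obtain ⟨n, hn, hkl⟩ := h.le_of_eigen hxy h0
      have : k + l = n := by exact_mod_cast hkl
      exact weightScaling_apply (by lia) hxy r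

theorem IsWeightDerivation.weightScaling_comp (h : IsWeightDerivation D m S) {r s : ℚ}
    (hrs : r * s = 1) (x : V) : weightScaling D m r (weightScaling D m s x) = x := by
  induction x using h.induction with
  | zero => simp
  | add u v hu hv => simp [hu, hv]
  | mem k hk x hx =>
    rw [weightScaling_apply hk hx, map_smul, weightScaling_apply hk hx, smul_smul, ← mul_pow,
      mul_comm s, hrs, one_pow, one_smul]

/-- The Lie algebra automorphism acting as `r ^ k` on the weight `k` eigenspace of `D`. -/
noncomputable def IsWeightDerivation.scalingEquiv (h : IsWeightDerivation D m S) {r s : ℚ}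
    (hrs : r * s = 1) : V ≃ₗ⁅ℚ⁆ V where
  toFun := weightScaling D m r
  map_add' := by simp
  map_smul' := by simp
  map_lie' := h.weightScaling_lie r _ _
  invFun := weightScaling D m s
  left_inv := h.weightScaling_comp (by rwa [mul_comm])
  right_inv := h.weightScaling_comp hrs

theorem baseChange_aeval_apply_of_eigen {A : Type*} [CommRing A] [Algebra ℚ A]
    {F : Module.End ℚ V} {μ : A} {x : A ⊗[ℚ] V} (hx : F.baseChange A x = μ • x) (q : ℚ[X]) :
    (aeval F q).baseChange A x = aeval μ q • x := by
  have h1 : (aeval F q).baseChange A = aeval (F.baseChange A) q :=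
    (aeval_algHom_apply (Module.End.baseChangeHom ℚ A V) F q).symm
  rw [h1]
  induction q using Polynomial.induction_on' with
  | add p q hp hq =>
    rw [map_add, LinearMap.add_apply, hp, hq, map_add, add_smul]
    all_goals exact (aeval_algHom_apply (Module.End.baseChangeHom ℚ A V) F _).symm
  | monomial n a =>
    have hn : (F.baseChange A ^ n) x = μ ^ n • x := by
      clear h1
      induction n with
      | zero => simp
      | succ n ih => rw [pow_succ', Module.End.mul_apply, ih, map_smul, hx, smul_smul, pow_succ]
    simp only [aeval_monomial, Module.End.mul_apply, hn, Module.algebraMap_end_apply, mul_smul,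
      algebraMap_smul]

theorem IsWeightDerivation.isIntegral_of_hasEigenvalue {A : Type*} [Field A] [Algebra ℚ A]
    (h : IsWeightDerivation D m S) {μ : A}
    (hμ : Module.End.HasEigenvalue ((weightScaling D m 2).baseChange A) μ) : IsIntegral ℤ μ := by
  obtain ⟨x, hx⟩ := hμ.exists_hasEigenvector
  let q : ℤ[X] := ∏ k ∈ Finset.range (m + 1), (X - C (2 ^ k : ℤ))
  refine ⟨q, monic_prod_of_monic _ _ fun k _ => monic_X_sub_C _, ?_⟩
  have h0 : aeval (weightScaling D m 2) (q.map (algebraMap ℤ ℚ)) = 0 := by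
    ext x
    induction x using h.induction with
    | zero => simp
    | add u v hu hv => rw [map_add, hu, hv]; simp
    | mem k hk x hx =>
      rw [aeval_rat_apply_of_eigen (weightScaling_apply hk hx 2)]
      have : (q.map (algebraMap ℤ ℚ)).eval (2 ^ k) = 0 := by
        simp only [q, Polynomial.map_prod, eval_prod]
        exact Finset.prod_eq_zero (Finset.mem_range.2 (by lia : k < m + 1)) (by simp)
      rw [this, zero_smul, LinearMap.zero_apply]
  have h1 := baseChange_aeval_apply_of_eigen hx.apply_eq_smul (q.map (algebraMap ℤ ℚ))
  rw [h0, LinearMap.baseChange_zero, LinearMap.zero_apply, aeval_map_algebraMap] at h1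
  exact (smul_eq_zero.1 h1.symm).resolve_right hx.2

theorem IsWeightDerivation.not_isIntegral_of_mem_baseChange {A : Type*} [Field A] [Algebra ℚ A]
    {Z : Submodule ℚ V} (h : IsWeightDerivation D m Z) {μ : A} {x : A ⊗[ℚ] V}
    (hxZ : x ∈ Z.baseChange A) (hx0 : x ≠ 0)
    (hx : (weightScaling D m 2⁻¹).baseChange A x = μ • x) : ¬ IsIntegral ℤ μ := by
  let q : ℚ[X] := ∏ k ∈ Finset.range m, (X - C ((2⁻¹ : ℚ) ^ (k + 1)))
  have h0 : (aeval (0 : ℚ) (weightPoly m)) • aeval (weightScaling D m 2⁻¹) q =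
      q.eval 1 • aeval D (weightPoly m) := by
    ext x
    induction x using h.induction with
    | zero => simp
    | add u v hu hv => rw [map_add, hu, hv, map_add]
    | mem k hk x hx =>
      simp only [LinearMap.smul_apply]
      rw [aeval_rat_apply_of_eigen (weightScaling_apply hk hx _), aeval_int_apply_of_eigen hx,
        smul_smul, smul_smul]
      rcases k.eq_zero_or_pos with rfl | hpos
      · simp [mul_comm]
      · rw [aeval_weightPoly_eq_zero_iff.2 ⟨k, hpos, hk, rfl⟩]
        have : q.eval (2⁻¹ ^ k) = 0 := by
          simp only [q, eval_prod]
          exact Finset.prod_eq_zero (Finset.mem_range.2 (by lia : k - 1 < m))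
            (by simp [Nat.sub_add_cancel hpos])
        rw [this, mul_zero, mul_zero]
  have hne : aeval (0 : ℚ) (weightPoly m) ≠ 0 := fun h0 => by
    obtain ⟨k, hk, -, hk0⟩ := aeval_weightPoly_eq_zero_iff.1 h0
    have : k = 0 := by exact_mod_cast hk0.symm
    lia
  have hZ : aeval (weightScaling D m 2⁻¹) q ∘ₗ Z.subtype = 0 := by
    ext z
    have := LinearMap.congr_fun h0 z
    rw [LinearMap.smul_apply, LinearMap.smul_apply, h.aeval_apply_eq_zero _ z.2, smul_zero] at this
    exact (smul_eq_zero.1 this).resolve_left hne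
  obtain ⟨w, rfl⟩ := hxZ
  have h1 := baseChange_aeval_apply_of_eigen hx q
  rw [← LinearMap.comp_apply, ← LinearMap.baseChange_comp, hZ, LinearMap.baseChange_zero,
    LinearMap.zero_apply] at h1
  have h2 := (smul_eq_zero.1 h1.symm).resolve_right hx0
  simp only [q, map_prod, Finset.prod_eq_zero_iff, map_sub, aeval_X, aeval_C, sub_eq_zero] at h2
  obtain ⟨k, -, rfl⟩ := h2
  intro hint
  rw [isIntegral_algebraMap_iff (algebraMap ℚ A).injective,
    IsIntegrallyClosed.isIntegral_iff] at hint
  obtain ⟨n, hn⟩ := hint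
  have h3 : (n : ℚ) * 2 ^ (k + 1) = 1 := by
    rw [← eq_intCast (algebraMap ℤ ℚ) n, hn, ← mul_pow]
    norm_num
  have h4 : n * 2 ^ (k + 1) = 1 := by exact_mod_cast h3
  have h5 : (2 : ℤ) ∣ 1 := h4 ▸ Dvd.dvd.mul_left (dvd_pow_self 2 (by lia)) n
  norm_num at h5

end Automorphism

section GenEigenspace

variable {K V : Type*} [CommRing K] [LieRing V] [LieAlgebra K V]

theorem pow_sub_smul_one_lie_eq_zero {T G H : Module.End K V} {α β γ : K} (hG : Commute T G)
    (hH : Commute T H)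
    (h : ∀ x y, (T - γ • 1) ⁅x, y⁆ = ⁅(T - α • 1) x, G y⁆ + ⁅H x, (T - β • 1) y⁆)
    (k l : ℕ) (x y : V) (hx : ((T - α • 1) ^ k) x = 0) (hy : ((T - β • 1) ^ l) y = 0) :
    ((T - γ • 1) ^ (k + l)) ⁅x, y⁆ = 0 := by
  have hG' : ∀ l : ℕ, Commute ((T - β • 1) ^ l) G := fun l =>
    (hG.sub_left ((Commute.one_left G).smul_left β)).pow_left l
  have hH' : ∀ l : ℕ, Commute ((T - α • 1) ^ l) H := fun l =>
    (hH.sub_left ((Commute.one_left H).smul_left α)).pow_left l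
  induction hn : k + l generalizing k l x y with
  | zero =>
    obtain rfl : k = 0 := by lia
    rw [pow_zero, Module.End.one_apply] at hx
    simp [hx]
  | succ n ih =>
    rcases k with _ | k
    · rw [pow_zero, Module.End.one_apply] at hx
      simp [hx]
    rcases l with _ | l
    · rw [pow_zero, Module.End.one_apply] at hy
      simp [hy]
    rw [pow_succ, Module.End.mul_apply, h, map_add,
      ih k (l + 1) _ _ (by rwa [← Module.End.mul_apply, ← pow_succ]) ?_ (by lia),
      ih (k + 1) l _ _ ?_ (by rwa [← Module.End.mul_apply, ← pow_succ]) (by lia), add_zero]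
    · rw [← Module.End.mul_apply, (hH' _).eq, Module.End.mul_apply, hx, map_zero]
    · rw [← Module.End.mul_apply, (hG' _).eq, Module.End.mul_apply, hy, map_zero]

theorem lie_mem_maxGenEigenspace_add_s9 {T : Module.End K V}
    (hT : ∀ x y, T ⁅x, y⁆ = ⁅T x, y⁆ + ⁅x, T y⁆) {α β : K} {x y : V}
    (hx : x ∈ T.maxGenEigenspace α) (hy : y ∈ T.maxGenEigenspace β) :
    ⁅x, y⁆ ∈ T.maxGenEigenspace (α + β) := by
  rw [Module.End.mem_maxGenEigenspace] at hx hy ⊢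
  obtain ⟨k, hk⟩ := hx
  obtain ⟨l, hl⟩ := hy
  refine ⟨k + l, pow_sub_smul_one_lie_eq_zero (Commute.one_right T) (Commute.one_right T)
    (fun x y => ?_) k l x y hk hl⟩
  simp [hT, add_smul]
  abel

theorem lie_mem_maxGenEigenspace_mul_s9 {T : Module.End K V}
    (hT : ∀ x y, T ⁅x, y⁆ = ⁅T x, T y⁆) {α β : K} {x y : V}
    (hx : x ∈ T.maxGenEigenspace α) (hy : y ∈ T.maxGenEigenspace β) :
    ⁅x, y⁆ ∈ T.maxGenEigenspace (α * β) := by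
  rw [Module.End.mem_maxGenEigenspace] at hx hy ⊢
  obtain ⟨k, hk⟩ := hx
  obtain ⟨l, hl⟩ := hy
  refine ⟨k + l, pow_sub_smul_one_lie_eq_zero (G := T) (H := α • 1) (Commute.refl T)
    ((Commute.one_right T).smul_right α) (fun x y => ?_) k l x y hk hl⟩
  simp [hT, smul_smul, mul_comm β]

end GenEigenspace

section Interpolation

variable {K Ω : Type*} [Field K] [Field Ω] [Algebra K Ω]

theorem exists_X_sub_C_pow_dvd_map_sub {S : Set Ω} (hS : S.Finite)
    (hint : ∀ α ∈ S, IsIntegral K α) (n : ℕ) (c : Ω → ℕ)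
    (hc : ∀ α ∈ S, ∀ β ∈ S, minpoly K α = minpoly K β → c α = c β) :
    ∃ p : K[X], ∀ α ∈ S,
      (X - C α) ^ n ∣ p.map (algebraMap K Ω) - C (c α : Ω) := by
  have hfin : (minpoly K '' S).Finite := hS.image _
  have : Finite (minpoly K '' S) := hfin
  choose f hf hfeq using fun q : minpoly K '' S => q.2
  obtain ⟨p, hp⟩ := Ideal.exists_forall_sub_mem_ideal
    (I := fun q : minpoly K '' S => Ideal.span {(q : K[X]) ^ n})
    (fun q r hqr => by
      rw [Function.onFun, Ideal.isCoprime_span_singleton_iff]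
      refine IsCoprime.pow ?_
      obtain ⟨_, α, hα, rfl⟩ := q
      obtain ⟨_, β, hβ, rfl⟩ := r
      rw [(minpoly.irreducible (hint α hα)).coprime_iff_not_dvd]
      intro hdvd
      refine hqr (Subtype.ext ?_)
      exact eq_of_monic_of_associated (minpoly.monic (hint α hα)) (minpoly.monic (hint β hβ))
        ((minpoly.irreducible (hint α hα)).associated_of_dvd
          (minpoly.irreducible (hint β hβ)) hdvd))
    (fun q => C (c (f q) : K))
  refine ⟨p, fun α hα => ?_⟩
  have h1 := hp ⟨minpoly K α, α, hα, rfl⟩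
  rw [Ideal.mem_span_singleton] at h1
  have h2 : c (f ⟨minpoly K α, α, hα, rfl⟩) = c α := hc _ (hf _) _ hα (hfeq _)
  rw [h2] at h1
  have h3 := Polynomial.map_dvd (algebraMap K Ω) h1
  rw [Polynomial.map_pow, Polynomial.map_sub, Polynomial.map_C, map_natCast] at h3
  refine (pow_dvd_pow_of_dvd ?_ n).trans h3
  rw [dvd_iff_isRoot, IsRoot, eval_map_algebraMap, minpoly.aeval]

end Interpolation

section Eigenvalues

variable {K Ω V Z : Type*} [Field K] [Field Ω] [Algebra K Ω]
  [AddCommGroup Z] [Module K Z] [FiniteDimensional K Z]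

theorem isIntegral_of_hasEigenvalue_baseChange {T : Module.End K Z} {α : Ω}
    (hα : Module.End.HasEigenvalue (T.baseChange Ω) α) : IsIntegral K α := by
  refine ⟨T.charpoly, T.charpoly_monic, ?_⟩
  rw [← eval_map, ← LinearMap.charpoly_baseChange]
  exact (Module.End.hasEigenvalue_iff_isRoot_charpoly _ _).1 hα

theorem hasEigenvalue_of_mem_maxGenEigenspace {A W : Type*} [CommRing A] [AddCommGroup W]
    [Module A W] {T : Module.End A W} {α : A} {x : W} (hx : x ∈ T.maxGenEigenspace α)
    (hx0 : x ≠ 0) : T.HasEigenvalue α := by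
  have : T.HasUnifEigenvalue α ⊤ := fun h => hx0 (by
    simpa [Module.End.maxGenEigenspace, h] using hx)
  exact this.lt zero_lt_one

variable [IsAlgClosed Ω] [CharZero Ω] [LieRing V] [LieAlgebra K V] [FiniteDimensional K V]

theorem exists_isWeightDerivation_of_eigenvalues (T : Module.End K V) (op : Ω → Ω → Ω)
    (hop : ∀ α β : Ω, ∀ x ∈ Module.End.maxGenEigenspace (T.baseChange Ω) α,
      ∀ y ∈ Module.End.maxGenEigenspace (T.baseChange Ω) β,
      ⁅x, y⁆ ∈ Module.End.maxGenEigenspace (T.baseChange Ω) (op α β))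
    (c : Ω → ℕ)
    (hminpoly : ∀ α β : Ω, Module.End.HasEigenvalue (T.baseChange Ω) α →
      Module.End.HasEigenvalue (T.baseChange Ω) β →
      minpoly K α = minpoly K β → c α = c β)
    (hadd : ∀ α β : Ω, Module.End.HasEigenvalue (T.baseChange Ω) α →
      Module.End.HasEigenvalue (T.baseChange Ω) β →
      Module.End.HasEigenvalue (T.baseChange Ω) (op α β) → c (op α β) = c α + c β)
    (S : Module.End K Z) (j : Z →ₗ[K] V) (hj : ∀ z, j (S z) = T (j z))
    (hpos : ∀ α : Ω, Module.End.HasEigenvalue (S.baseChange Ω) α → 0 < c α) :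
    ∃ (D : Module.End K V) (m : ℕ), IsWeightDerivation D m (Set.range j) := by
  have hfin := Module.End.finite_hasEigenvalue (T.baseChange Ω)
  obtain ⟨p, hp⟩ := exists_X_sub_C_pow_dvd_map_sub (K := K) hfin
    (fun α hα => isIntegral_of_hasEigenvalue_baseChange hα)
    (Module.finrank Ω (Ω ⊗[K] V)) c (fun α hα β hβ => hminpoly α β hα hβ)
  obtain ⟨m, hm⟩ := (hfin.image c).bddAbove
  have hm : ∀ α : Ω, ∀ x ∈ Module.End.maxGenEigenspace (T.baseChange Ω) α, x ≠ 0 → c α ≤ m :=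
    fun α x hx hx0 => hm ⟨α, hasEigenvalue_of_mem_maxGenEigenspace hx hx0, rfl⟩
  have hD : ∀ α : Ω, ∀ x ∈ Module.End.maxGenEigenspace (T.baseChange Ω) α,
      (aeval T p).baseChange Ω x = (c α : Ω) • x := by
    intro α x hx
    by_cases hx0 : x = 0
    · simp [hx0]
    have hα := hasEigenvalue_of_mem_maxGenEigenspace hx hx0
    have h1 : (aeval T p).baseChange Ω = aeval (T.baseChange Ω) (p.map (algebraMap K Ω)) := by
      rw [aeval_map_algebraMap]
      exact (aeval_algHom_apply (Module.End.baseChangeHom K Ω V) T p).symm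
    obtain ⟨r, hr⟩ := hp α hα
    rw [Module.End.maxGenEigenspace_eq_genEigenspace_finrank, Module.End.mem_genEigenspace_nat,
      LinearMap.mem_ker] at hx
    rw [h1, sub_eq_iff_eq_add.1 hr, mul_comm, map_add, map_mul, LinearMap.add_apply,
      Module.End.mul_apply, map_pow, map_sub, aeval_X, aeval_C, aeval_C,
      Module.algebraMap_end_apply]
    have : algebraMap Ω (Module.End Ω (Ω ⊗[K] V)) α = α • 1 := by
      rw [Algebra.algebraMap_eq_smul_one]
    rw [this, hx, map_zero, zero_add]
  have htop := Module.End.iSup_maxGenEigenspace_eq_top (T.baseChange Ω)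
  refine ⟨aeval T p, m, ?_⟩
  have key : IsWeightDerivation ((aeval T p).baseChange Ω) m
      ((fun z => (1 : Ω) ⊗ₜ[K] j z) '' Set.univ) := by
    refine ⟨leibniz_of_iSup_eq_top _ _ htop fun α β x hx y hy => ?_, ?_, ?_⟩
    · rw [hD _ _ (hop α β x hx y hy), hD α x hx, hD β y hy, smul_lie, lie_smul, ← add_smul,
        ← Nat.cast_add]
      by_cases hxy : ⁅x, y⁆ = 0
      · simp [hxy]
      rw [hadd α β]
      · exact hasEigenvalue_of_mem_maxGenEigenspace hx fun h => hxy (by simp [h])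
      · exact hasEigenvalue_of_mem_maxGenEigenspace hy fun h => hxy (by simp [h])
      · exact hasEigenvalue_of_mem_maxGenEigenspace (hop α β x hx y hy) hxy
    · refine LinearMap.ext fun x => ?_
      have hx : x ∈ ⨆ i, Module.End.maxGenEigenspace (T.baseChange Ω) i := htop ▸ Submodule.mem_top
      refine Submodule.iSup_induction _ (motive := fun x => aeval ((aeval T p).baseChange Ω)
        (X * weightPoly m) x = (0 : Module.End Ω (Ω ⊗[K] V)) x) hx (fun α x hx => ?_) (by simp)
        fun a b ha hb => by rw [map_add, ha, hb, map_add]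
      by_cases hx0 : x = 0
      · simp [hx0]
      rw [aeval_int_apply_of_eigen (hD α x hx),
        aeval_X_mul_weightPoly_eq_zero_iff.2 ⟨c α, hm α x hx hx0, rfl⟩]
      simp
    · rintro _ ⟨z, -, rfl⟩
      have htopZ := Module.End.iSup_maxGenEigenspace_eq_top (S.baseChange Ω)
      suffices h : ∀ w, aeval ((aeval T p).baseChange Ω) (weightPoly m) (j.baseChange Ω w) = 0 by
        simpa using h (1 ⊗ₜ z)
      intro w
      have hw : w ∈ ⨆ i, Module.End.maxGenEigenspace (S.baseChange Ω) i := htopZ ▸ Submodule.mem_top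
      refine Submodule.iSup_induction _ (motive := fun w => aeval ((aeval T p).baseChange Ω)
        (weightPoly m) (j.baseChange Ω w) = 0) hw (fun α w hw => ?_) (by simp)
        fun a b ha hb => by rw [map_add, map_add, ha, hb, add_zero]
      by_cases hw0 : j.baseChange Ω w = 0
      · rw [hw0, map_zero]
      have hcomm : ∀ w, j.baseChange Ω (S.baseChange Ω w) =
          T.baseChange Ω (j.baseChange Ω w) := by
        intro w
        rw [← LinearMap.comp_apply, ← LinearMap.comp_apply, ← LinearMap.baseChange_comp,
          ← LinearMap.baseChange_comp]
        congr 2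
        exact LinearMap.ext hj
      have hjw : j.baseChange Ω w ∈ Module.End.maxGenEigenspace (T.baseChange Ω) α := by
        rw [Module.End.mem_maxGenEigenspace] at hw ⊢
        obtain ⟨k, hk⟩ := hw
        refine ⟨k, ?_⟩
        have h2 : ∀ k : ℕ, ∀ w, j.baseChange Ω (((S.baseChange Ω - α • 1) ^ k) w) =
            ((T.baseChange Ω - α • 1) ^ k) (j.baseChange Ω w) := by
          intro k
          induction k with
          | zero => simp
          | succ k ih => intro w; simp [pow_succ, ih, hcomm]
        rw [← h2, hk, map_zero]
      rw [aeval_int_apply_of_eigen (hD α _ hjw), aeval_weightPoly_eq_zero_iff.2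
        ⟨c α, hpos α (hasEigenvalue_of_mem_maxGenEigenspace hw fun h => hw0 (by rw [h, map_zero])),
          hm α _ hjw hw0, rfl⟩, zero_smul]
  refine key.of_injective (TensorProduct.mk K Ω V 1).toAddMonoidHom (fun x y => ?_) ?_ ?_ ?_
  · simp [LieAlgebra.ExtendScalars.bracket_tmul]
  · exact Module.FaithfullyFlat.tensorProduct_mk_injective (A := K) (B := Ω) V
  · simp
  · rintro _ ⟨z, rfl⟩
    exact ⟨z, trivial, rfl⟩

end Eigenvalues

section NormLength

variable {L : Type*} [Field L]

theorem norm_eq_of_minpoly_eq {K : Type*} [Field K] [Algebra K L] [FiniteDimensional K L]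
    {x y : L} (h : minpoly K x = minpoly K y) : Algebra.norm K x = Algebra.norm K y := by
  have hfin : ∀ x : L, (minpoly K x).natDegree *
      Module.finrank (IntermediateField.adjoin K {x}) L = Module.finrank K L := by
    intro x
    rw [← IntermediateField.adjoin.finrank (IsIntegral.of_finite K x), Module.finrank_mul_finrank]
  apply (algebraMap K (AlgebraicClosure K)).injective
  rw [Algebra.norm_eq_prod_roots _ (IsAlgClosed.splits _),
    Algebra.norm_eq_prod_roots _ (IsAlgClosed.splits _), h]
  congr 1
  have hx := hfin x
  rw [h, ← hfin y] at hx
  exact Nat.eq_of_mul_eq_mul_left (minpoly.natDegree_pos (IsIntegral.of_finite K y)) hx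

variable [NumberField L]

/-- The number of prime factors of the norm of `x⁻¹`, when `x⁻¹` is an algebraic integer. -/
noncomputable def invNormLength (x : L) : ℕ :=
  ArithmeticFunction.cardFactors (Algebra.norm ℚ x⁻¹).num.natAbs

theorem exists_norm_eq_intCast {x : L} (hx : IsIntegral ℤ x) :
    ∃ n : ℤ, Algebra.norm ℚ x = n := by
  obtain ⟨n, hn⟩ := IsIntegrallyClosed.isIntegral_iff.1 (Algebra.isIntegral_norm ℚ hx)
  exact ⟨n, by simpa using hn.symm⟩

theorem invNormLength_mul {x y : L} (hx0 : x ≠ 0) (hy0 : y ≠ 0) (hx : IsIntegral ℤ x⁻¹)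
    (hy : IsIntegral ℤ y⁻¹) : invNormLength (x * y) = invNormLength x + invNormLength y := by
  obtain ⟨k, hk⟩ := exists_norm_eq_intCast hx
  obtain ⟨l, hl⟩ := exists_norm_eq_intCast hy
  have hne : ∀ {x : L} {k : ℤ}, x ≠ 0 → Algebra.norm ℚ x⁻¹ = k → k.natAbs ≠ 0 := by
    rintro x k hx0 hk h0
    obtain rfl := Int.natAbs_eq_zero.1 h0
    rw [Int.cast_zero, Algebra.norm_eq_zero_iff] at hk
    exact inv_ne_zero hx0 hk
  simp only [invNormLength]
  rw [mul_inv, map_mul, hk, hl, ← Int.cast_mul, Rat.num_intCast, Rat.num_intCast, Rat.num_intCast,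
    Int.natAbs_mul, ArithmeticFunction.cardFactors_mul (hne hx0 hk) (hne hy0 hl)]

theorem invNormLength_pos {x : L} (hx : IsIntegral ℤ x⁻¹) (hx' : ¬ IsIntegral ℤ x) :
    0 < invNormLength x := by
  have hx0 : x ≠ 0 := fun h => hx' (h ▸ isIntegral_zero)
  obtain ⟨k, hk⟩ := exists_norm_eq_intCast hx
  rw [Nat.pos_iff_ne_zero]
  intro h
  rw [invNormLength, hk, Rat.num_intCast,
    ArithmeticFunction.cardFactors_eq_zero_iff_eq_zero_or_one] at h
  rcases h with h | h
  · obtain rfl := Int.natAbs_eq_zero.1 h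
    rw [Int.cast_zero, Algebra.norm_eq_zero_iff] at hk
    exact inv_ne_zero hx0 hk
  · let u : NumberField.RingOfIntegers L := ⟨x⁻¹, hx⟩
    have hu : IsUnit u := by
      rw [NumberField.isUnit_iff_norm, RingOfIntegers.coe_norm]
      change |Algebra.norm ℚ x⁻¹| = 1
      rw [hk, ← Int.cast_abs, Int.abs_eq_natAbs, h]
      simp
    obtain ⟨v, hv⟩ := hu.exists_right_inv
    have hv' : x⁻¹ * (v : L) = 1 := congrArg (algebraMap (NumberField.RingOfIntegers L) L) hv
    have : x = v := by field_simp at hv'; exact hv'.symm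
    exact hx' (this ▸ v.isIntegral_coe)

theorem invNormLength_eq_of_minpoly_eq {x y : L} (h : minpoly ℚ x = minpoly ℚ y) :
    invNormLength x = invNormLength y := by
  have (x : L) : Algebra.norm ℚ x⁻¹ = (Algebra.norm ℚ x)⁻¹ := by
    by_cases hx : x = 0
    · simp [hx]
    · rw [← mul_eq_one_iff_eq_inv₀ (Algebra.norm_ne_zero_iff.2 hx), ← map_mul, inv_mul_cancel₀ hx,
        map_one]
  rw [invNormLength, invNormLength, this, this, norm_eq_of_minpoly_eq h]

end NormLength

section OfAutomorphism

variable {V : Type*} [LieRing V]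

theorem map_lie_baseChange {K A : Type*} [CommRing K] [CommRing A] [Algebra K A] [LieAlgebra K V]
    {T : Module.End K V} (h : ∀ x y, T ⁅x, y⁆ = ⁅T x, T y⁆) (u v : A ⊗[K] V) :
    T.baseChange A ⁅u, v⁆ = ⁅T.baseChange A u, T.baseChange A v⁆ := by
  induction u using TensorProduct.induction_on with
  | zero => simp
  | tmul a x =>
    induction v using TensorProduct.induction_on with
    | zero => simp
    | tmul b y => simp [LieAlgebra.ExtendScalars.bracket_tmul, h]
    | add u v hu hv => simp only [lie_add, map_add, hu, hv]
  | add u v hu hv => simp only [add_lie, map_add, hu, hv]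

variable [LieAlgebra ℚ V] [FiniteDimensional ℚ V] {Ω : Type*} [Field Ω] [IsAlgClosed Ω]
  [CharZero Ω]

theorem exists_isWeightDerivation_of_lieEquiv (f : V ≃ₗ⁅ℚ⁆ V)
    (hcenter : ∀ μ : Ω,
      (∃ x ∈ Submodule.baseChange Ω (LieAlgebra.center ℚ V).toSubmodule,
        x ≠ 0 ∧
          LinearMap.baseChange Ω f.toLieHom.toLinearMap x = μ • x) →
      ¬ IsIntegral ℤ μ)
    (hsymm : ∀ μ : Ω,
      Module.End.HasEigenvalue
        (LinearMap.baseChange Ω f.symm.toLieHom.toLinearMap) μ →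
      IsIntegral ℤ μ) :
    ∃ (D : Module.End ℚ V) (m : ℕ),
      IsWeightDerivation D m (LieAlgebra.center ℚ V : Set V) := by
  let T : Module.End ℚ V := f.toLieHom.toLinearMap
  let T' : Module.End ℚ V := f.symm.toLieHom.toLinearMap
  have hT : ∀ x y, T ⁅x, y⁆ = ⁅T x, T y⁆ := fun x y => f.toLieHom.map_lie x y
  have hT' : ∀ w, T'.baseChange Ω (T.baseChange Ω w) = w := by
    intro w
    rw [← LinearMap.comp_apply, ← LinearMap.baseChange_comp]
    have : T' ∘ₗ T = LinearMap.id := LinearMap.ext fun x => f.symm_apply_apply x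
    rw [this, LinearMap.baseChange_id, LinearMap.id_apply]
  have hinv : ∀ α : Ω, Module.End.HasEigenvalue (T.baseChange Ω) α →
      α ≠ 0 ∧ IsIntegral ℤ α⁻¹ := by
    intro α hα
    obtain ⟨x, hx⟩ := hα.exists_hasEigenvector
    have h1 := hT' x
    rw [hx.apply_eq_smul, map_smul] at h1
    have hα0 : α ≠ 0 := fun h0 => hx.2 (by rw [← h1, h0, zero_smul])
    refine ⟨hα0, hsymm _ (Module.End.hasEigenvalue_of_hasEigenvector (x := x)
      ⟨Module.End.mem_eigenspace_iff.2 ?_, hx.2⟩)⟩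
    rw [eq_inv_smul_iff₀ hα0]
    exact h1
  have hfin : {α | Module.End.HasEigenvalue (T.baseChange Ω) α}.Finite :=
    Module.End.finite_hasEigenvalue _
  let L := IntermediateField.adjoin ℚ {α | Module.End.HasEigenvalue (T.baseChange Ω) α}
  have : Finite {α | Module.End.HasEigenvalue (T.baseChange Ω) α} := hfin
  have : FiniteDimensional ℚ L := IntermediateField.finiteDimensional_adjoin
    fun α hα => isIntegral_of_hasEigenvalue_baseChange hα
  have : NumberField L := ⟨⟩
  have hL : ∀ {α}, Module.End.HasEigenvalue (T.baseChange Ω) α → α ∈ L :=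
    fun hα => IntermediateField.subset_adjoin _ _ hα
  have hLint : ∀ x : L, IsIntegral ℤ x ↔ IsIntegral ℤ (x : Ω) := fun x =>
    (isIntegral_algHom_iff (L.val.restrictScalars ℤ) L.val.injective).symm
  have hmin : ∀ x : L, minpoly ℚ x = minpoly ℚ (x : Ω) :=
    fun x => (minpoly.algHom_eq L.val L.val.injective x).symm
  classical
  let c : Ω → ℕ := fun α => if h : α ∈ L then invNormLength (⟨α, h⟩ : L) else 0
  have hc : ∀ {α}, (h : α ∈ L) → c α = invNormLength (⟨α, h⟩ : L) := fun h => dif_pos h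
  have hcen : ∀ z ∈ (LieAlgebra.center ℚ V).toSubmodule,
      T z ∈ (LieAlgebra.center ℚ V).toSubmodule := by
    intro z hz
    change z ∈ LieAlgebra.center ℚ V at hz
    change T z ∈ LieAlgebra.center ℚ V
    rw [LieModule.mem_maxTrivSubmodule] at hz ⊢
    intro x
    have : x = T (T' x) := (f.apply_symm_apply x).symm
    rw [this, ← hT, hz, map_zero]
  have hrange : Set.range (LieAlgebra.center ℚ V).toSubmodule.subtype =
      (LieAlgebra.center ℚ V : Set V) := Subtype.range_coe
  rw [← hrange]
  refine exists_isWeightDerivation_of_eigenvalues (Ω := Ω) T (· * ·)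
    (fun α β x hx y hy => lie_mem_maxGenEigenspace_mul_s9 (map_lie_baseChange hT) hx hy) c
    (fun α β hα hβ h => ?_) (fun α β hα hβ hαβ => ?_) (T.restrict hcen)
    (LieAlgebra.center ℚ V).toSubmodule.subtype (fun z => rfl) (fun α hα => ?_)
  · rw [hc (hL hα), hc (hL hβ)]
    refine invNormLength_eq_of_minpoly_eq ?_
    exact ((hmin _).trans h).trans (hmin _).symm
  · rw [hc (hL hα), hc (hL hβ), hc (hL hαβ), ← invNormLength_mul]
    · rfl
    · exact fun h => (hinv α hα).1 (congrArg Subtype.val h)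
    · exact fun h => (hinv β hβ).1 (congrArg Subtype.val h)
    · exact (hLint _).2 (hinv α hα).2
    · exact (hLint _).2 (hinv β hβ).2
  · obtain ⟨w, hw⟩ := hα.exists_hasEigenvector
    let j := (LieAlgebra.center ℚ V).toSubmodule.subtype
    have hj : Function.Injective (j.baseChange Ω) :=
      Module.Flat.lTensor_preserves_injective_linearMap (M := Ω) j (Submodule.subtype_injective _)
    have hne : j.baseChange Ω w ≠ 0 := fun h0 => hw.2 (hj (by rw [h0, map_zero]))
    have heig : T.baseChange Ω (j.baseChange Ω w) = α • j.baseChange Ω w := by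
      rw [← map_smul, ← hw.apply_eq_smul, ← LinearMap.comp_apply, ← LinearMap.baseChange_comp,
        ← LinearMap.comp_apply, ← LinearMap.baseChange_comp]
      rfl
    have hα' : Module.End.HasEigenvalue (T.baseChange Ω) α :=
      Module.End.hasEigenvalue_of_hasEigenvector (x := j.baseChange Ω w)
        ⟨Module.End.mem_eigenspace_iff.2 heig, hne⟩
    rw [hc (hL hα')]
    refine invNormLength_pos ((hLint _).2 (hinv α hα').2) fun hint => ?_
    exact hcenter α ⟨j.baseChange Ω w, ⟨w, rfl⟩, hne, heig⟩ ((hLint _).1 hint)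

end OfAutomorphism

section Pencil

variable {K V σ : Type*} [CommRing K] [Fintype σ]

/-- The endomorphism `∑ i, x i • E i` of `A ⊗ V`. -/
noncomputable def pencil [AddCommGroup V] [Module K V] {A : Type*} [CommRing A] [Algebra K A]
    (E : σ → Module.End K V) (x : σ → A) : Module.End A (A ⊗[K] V) :=
  ∑ i, x i • (E i).baseChange A

variable {A B : Type*} [CommRing A] [Algebra K A] [CommRing B] [Algebra K B]

theorem pencil_one_tmul [AddCommGroup V] [Module K V] (E : σ → Module.End K V) (x : σ → A)
    (v : V) : pencil E x (1 ⊗ₜ v) = ∑ i, x i ⊗ₜ[K] E i v := by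
  simp [pencil, LinearMap.sum_apply, TensorProduct.smul_tmul']

theorem pencil_intertwine {W : Type*} [AddCommGroup V] [Module K V] [AddCommGroup W] [Module K W]
    {E : σ → Module.End K V} {F : σ → Module.End K W} {j : W →ₗ[K] V}
    (hj : ∀ i w, j (F i w) = E i (j w)) (x : σ → A) (w : A ⊗[K] W) :
    j.baseChange A (pencil F x w) = pencil E x (j.baseChange A w) := by
  simp only [pencil, LinearMap.sum_apply, map_sum, LinearMap.smul_apply, map_smul]
  refine Finset.sum_congr rfl fun i _ => ?_
  rw [← LinearMap.comp_apply, ← LinearMap.baseChange_comp, ← LinearMap.comp_apply,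
    ← LinearMap.baseChange_comp, show j ∘ₗ F i = E i ∘ₗ j from LinearMap.ext (hj i)]

theorem toMatrix_pencil {ι : Type*} [Fintype ι] [DecidableEq ι] [AddCommGroup V] [Module K V]
    (b : Module.Basis ι K V) (E : σ → Module.End K V) (x : σ → A) :
    LinearMap.toMatrix (b.baseChange A) (b.baseChange A) (pencil E x) =
      ∑ i, x i • (LinearMap.toMatrix b b (E i)).map (algebraMap K A) := by
  rw [pencil, map_sum]
  refine Finset.sum_congr rfl fun i _ => ?_
  rw [map_smul]
  ext
  simp [LinearMap.toMatrix_apply, Algebra.smul_def, mul_comm]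

theorem pencil_charpoly_map [AddCommGroup V] [Module K V] [Module.Free K V] [Module.Finite K V]
    [Nontrivial A] [Nontrivial B]
    (E : σ → Module.End K V) (x : σ → A) (φ : A →ₐ[K] B) :
    (pencil E x).charpoly.map (φ : A →+* B) = (pencil E (φ ∘ x)).charpoly := by
  classical
  let b := Module.Free.chooseBasis K V
  rw [← LinearMap.charpoly_toMatrix _ (b.baseChange A),
    ← LinearMap.charpoly_toMatrix _ (b.baseChange B), ← Matrix.charpoly_map, toMatrix_pencil,
    toMatrix_pencil]
  congr 1
  ext i j
  simp [Matrix.sum_apply]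

theorem leibniz_pencil [LieRing V] [LieAlgebra K V] {E : σ → Module.End K V}
    (h : ∀ i x y, E i ⁅x, y⁆ = ⁅E i x, y⁆ + ⁅x, E i y⁆) (x : σ → A) (u v : A ⊗[K] V) :
    pencil E x ⁅u, v⁆ = ⁅pencil E x u, v⁆ + ⁅u, pencil E x v⁆ := by
  simp only [pencil, LinearMap.sum_apply, LinearMap.smul_apply, leibniz_baseChange (h _),
    sum_lie, lie_sum, smul_lie, lie_smul, ← Finset.sum_add_distrib, smul_add]

theorem map_center_of_leibniz [LieRing V] [LieAlgebra K V] {D : Module.End K V}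
    (h : ∀ x y, D ⁅x, y⁆ = ⁅D x, y⁆ + ⁅x, D y⁆) {z : V} (hz : z ∈ LieAlgebra.center K V) :
    D z ∈ LieAlgebra.center K V := by
  rw [LieModule.mem_maxTrivSubmodule] at hz ⊢
  intro x
  simpa [hz] using (h x z).symm

end Pencil

section Decompose

variable {K A V : Type*} [Field K] [CommRing A] [Algebra K A] [LieRing V] [LieAlgebra K V]
  [FiniteDimensional K V]

theorem exists_eq_pencil {D : Module.End A (A ⊗[K] V)}
    (hD : ∀ u v, D ⁅u, v⁆ = ⁅D u, v⁆ + ⁅u, D v⁆) :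
    ∃ (n : ℕ) (E : Fin n → Module.End K V) (d : Fin n → A),
      (∀ i x y, E i ⁅x, y⁆ = ⁅E i x, y⁆ + ⁅x, E i y⁆) ∧ D = pencil E d := by
  classical
  let b := Module.Free.chooseBasis K A
  let e := Module.finBasis K V
  let E : Module.Free.ChooseBasisIndex K A → Module.End K V := fun i =>
    tensorSlice (b.coord i) ∘ₗ D.restrictScalars K ∘ₗ TensorProduct.mk K A V 1
  have hE : ∀ i x, E i x = tensorSlice (b.coord i) (D (1 ⊗ₜ x)) := fun i x => rfl
  let F := TensorProduct.equivFinsuppOfBasisLeft (N := V) b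
  have hF : ∀ w i, F w i = tensorSlice (b.coord i) w := by
    intro w i
    induction w using TensorProduct.induction_on with
    | zero => simp
    | tmul a x => simp [F]
    | add u v hu hv => simp [hu, hv]
  let S : Finset (Module.Free.ChooseBasisIndex K A) :=
    Finset.univ.biUnion fun j => (F (D (1 ⊗ₜ e j))).support
  have hS : ∀ i ∉ S, E i = 0 := by
    intro i hi
    refine e.ext fun j => ?_
    rw [hE, ← hF, LinearMap.zero_apply, ← Finsupp.notMem_support_iff]
    exact fun h => hi (Finset.mem_biUnion.2 ⟨j, Finset.mem_univ j, h⟩)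
  refine ⟨S.card, fun k => E (S.equivFin.symm k), fun k => b (S.equivFin.symm k),
    fun k x y => ?_, ?_⟩
  · have : (1 : A) ⊗ₜ[K] ⁅x, y⁆ = ⁅(1 : A) ⊗ₜ[K] x, (1 : A) ⊗ₜ[K] y⁆ := by
      simp [LieAlgebra.ExtendScalars.bracket_tmul]
    simp only [hE]
    rw [this, hD, map_add, lie_tensorSlice_left, lie_tensorSlice_right]
  · ext x
    simp only [LinearMap.coe_restrictScalars, TensorProduct.AlgebraTensorModule.curry_apply,
      TensorProduct.curry_apply, pencil_one_tmul]
    apply F.injective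
    ext i
    rw [hF, hF, map_sum]
    simp only [tensorSlice_tmul]
    rw [Equiv.sum_comp S.equivFin.symm (fun i' : S => b.coord i (b i') • E i' x)]
    rw [Finset.sum_coe_sort S (fun i' => b.coord i (b i') • E i' x)]
    rw [← hE]
    by_cases hi : i ∈ S
    · rw [Finset.sum_eq_single_of_mem i hi]
      · simp
      · intro i' _ hne
        simp [Finsupp.single_eq_of_ne hne.symm]
    · rw [hS i hi, Finset.sum_eq_zero]
      · simp
      · intro i' hi'
        have hne : i ≠ i' := fun h => hi (h ▸ hi')
        simp [Finsupp.single_eq_of_ne hne]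

end Decompose

section Trace

variable {A K Ω F : Type*} [CommRing A] [IsDomain A] [IsIntegrallyClosed A] [Algebra ℚ A]
  [Field K] [Algebra A K] [IsFractionRing A K] [Algebra ℚ K] [CharZero K]
  [Field Ω] [Algebra K Ω] [Algebra A Ω] [IsScalarTower A K Ω] [Algebra.IsIntegral K Ω]
  [Field F] [IsAlgClosed F] [CharZero F] [Algebra ℚ F]

theorem exists_factorial_mul_normalizedTrace_eq (ψ : A →ₐ[ℚ] F) (φ : K →ₗ[ℚ] F)
    (hφ : ∀ a, φ (algebraMap A K a) = ψ a) {α : Ω} {χ : A[X]} (hmonic : χ.Monic)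
    (hα : aeval α χ = 0) {N : ℕ} (hN : χ.natDegree ≤ N)
    (hroots : ∀ μ, (χ.map (ψ : A →+* F)).IsRoot μ → ∃ k : ℕ, μ = k) :
    ∃ k : ℕ, (N.factorial : F) * φ (Algebra.normalizedTrace K Ω α) = k ∧
      ((∀ μ, (χ.map (ψ : A →+* F)).IsRoot μ → μ ≠ 0) → 0 < k) := by
  have hinj : Function.Injective (algebraMap A Ω) := by
    rw [IsScalarTower.algebraMap_eq A K Ω]
    exact (algebraMap K Ω).injective.comp (IsFractionRing.injective A K)
  have : FaithfulSMul A Ω := (faithfulSMul_iff_algebraMap_injective A Ω).2 hinj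
  have hint : IsIntegral A α := ⟨χ, hmonic, hα⟩
  let P := minpoly A α
  have hP : P.Monic := minpoly.monic hint
  have hdvd : P ∣ χ := minpoly.isIntegrallyClosed_dvd hint hα
  have hpos : 0 < P.natDegree := minpoly.natDegree_pos hint
  have hle : P.natDegree ≤ N := (natDegree_le_of_dvd hdvd hmonic.ne_zero).trans hN
  have hsplits : (P.map (ψ : A →+* F)).Splits := IsAlgClosed.splits _
  have hdeg : (P.map (ψ : A →+* F)).natDegree = P.natDegree := hP.natDegree_map _
  have hroot : ∀ μ ∈ (P.map (ψ : A →+* F)).roots, (χ.map (ψ : A →+* F)).IsRoot μ := by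
    intro μ hμ
    exact (isRoot_of_mem_roots hμ).dvd (Polynomial.map_dvd _ hdvd)
  have htrace : φ (Algebra.normalizedTrace K Ω α) =
      (P.natDegree : F)⁻¹ * (P.map (ψ : A →+* F)).roots.sum := by
    rw [Algebra.normalizedTrace_minpoly, minpoly.isIntegrallyClosed_eq_field_fractions' K hint,
      (minpoly.monic hint).natDegree_map, nextCoeff_map (IsFractionRing.injective A K)]
    change φ ((P.natDegree : K)⁻¹ • -algebraMap A K P.nextCoeff) = _
    have h1 : (P.natDegree : K)⁻¹ • -algebraMap A K P.nextCoeff =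
        (P.natDegree : ℚ)⁻¹ • -algebraMap A K P.nextCoeff := by
      rw [smul_eq_mul, Algebra.smul_def, map_inv₀, map_natCast]
    have h2 : ψ P.nextCoeff = (P.map (ψ : A →+* F)).nextCoeff := by
      rw [nextCoeff_of_natDegree_pos hpos, nextCoeff_of_natDegree_pos (hdeg ▸ hpos), hdeg,
        coeff_map]
      rfl
    rw [h1, map_smul, map_neg, hφ, h2, hsplits.nextCoeff_eq_neg_sum_roots_of_monic (hP.map _),
      neg_neg, Algebra.smul_def, map_inv₀, map_natCast]
  have hcard : (P.map (ψ : A →+* F)).roots.card = P.natDegree := by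
    rw [← hsplits.natDegree_eq_card_roots, hdeg]
  generalize (P.map (ψ : A →+* F)).roots = s at *
  have hs : ∀ μ ∈ s, ∃ k : ℕ, (k : F) = μ := fun μ hμ =>
    (hroots μ (hroot μ hμ)).imp fun _ h => h.symm
  have : CanLift F ℕ Nat.cast fun μ => ∃ k : ℕ, (k : F) = μ := ⟨fun _ h => h⟩
  lift s to Multiset ℕ using hs
  obtain ⟨q, hq⟩ := Nat.dvd_factorial hpos hle
  refine ⟨q * s.sum, ?_, fun h => ?_⟩
  · rw [htrace, hq]
    have : (P.natDegree : F) ≠ 0 := by exact_mod_cast hpos.ne'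
    push_cast
    field_simp
  · refine Nat.mul_pos (Nat.pos_of_ne_zero fun h0 => N.factorial_ne_zero (by rw [hq, h0, mul_zero]))
      ?_
    rw [Multiset.card_map] at hcard
    obtain ⟨a, ha⟩ := Multiset.card_pos_iff_exists_mem.1 (hcard ▸ hpos)
    have ha' := h a (hroot _ (Multiset.mem_map_of_mem _ ha))
    exact (Nat.pos_of_ne_zero (by exact_mod_cast ha')).trans_le (Multiset.le_sum_of_mem ha)

end Trace

section GenericPencil

variable {V F σ : Type*} [LieRing V] [LieAlgebra ℚ V] [FiniteDimensional ℚ V]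
  [Field F] [IsAlgClosed F] [CharZero F] [Algebra ℚ F] [Fintype σ]

theorem aeval_charpoly_of_hasEigenvalue_baseChange {K Ω Z : Type*} [Field K] [Field Ω]
    [Algebra K Ω] [AddCommGroup Z] [Module K Z] [FiniteDimensional K Z] {T : Module.End K Z}
    {α : Ω} (hα : Module.End.HasEigenvalue (T.baseChange Ω) α) : aeval α T.charpoly = 0 := by
  rw [← eval_map_algebraMap, ← LinearMap.charpoly_baseChange]
  exact (Module.End.hasEigenvalue_iff_isRoot_charpoly _ _).1 hα

theorem baseChange_subtype_mem_center {K A W : Type*} [CommRing K] [CommRing A] [Algebra K A]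
    [LieRing W] [LieAlgebra K W] (w : A ⊗[K] (LieAlgebra.center K W).toSubmodule) :
    (LieAlgebra.center K W).toSubmodule.subtype.baseChange A w ∈
      LieAlgebra.center A (A ⊗[K] W) := by
  induction w using TensorProduct.induction_on with
  | zero => simp
  | tmul a z =>
    have := Submodule.smul_mem (LieAlgebra.center A (A ⊗[K] W)).toSubmodule a
      (one_tmul_mem_center (A := A) z.2)
    simpa [TensorProduct.smul_tmul'] using this
  | add u v hu hv => rw [map_add]; exact add_mem hu hv

theorem exists_isWeightDerivation_fractionRing {E : σ → Module.End ℚ V} {d : σ → F} {m : ℕ}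
    (hE : ∀ i x y, E i ⁅x, y⁆ = ⁅E i x, y⁆ + ⁅x, E i y⁆)
    (h : IsWeightDerivation (pencil E d) m (LieAlgebra.center F (F ⊗[ℚ] V) : Set (F ⊗[ℚ] V)))
    (K : Type*) [Field K] [Algebra (MvPolynomial σ ℚ) K] [IsFractionRing (MvPolynomial σ ℚ) K]
    [CharZero K] [Algebra ℚ K] [IsScalarTower ℚ (MvPolynomial σ ℚ) K] :
    ∃ (D : Module.End K (K ⊗[ℚ] V)) (n : ℕ), IsWeightDerivation D n
      (Set.range ((LieAlgebra.center ℚ V).toSubmodule.subtype.baseChange K)) := by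
  let A := MvPolynomial σ ℚ
  let Z := (LieAlgebra.center ℚ V).toSubmodule
  let Ω := AlgebraicClosure K
  let ψ : A →ₐ[ℚ] F := MvPolynomial.aeval d
  have hE' : ∀ i, ∀ z ∈ Z, E i z ∈ Z := fun i z hz => map_center_of_leibniz (hE i) hz
  let S : σ → Module.End ℚ Z := fun i => (E i).restrict (hE' i)
  have hS : ∀ i z, Z.subtype (S i z) = E i (Z.subtype z) := fun i z => rfl
  let t : σ → K := fun i => algebraMap A K (MvPolynomial.X i)
  obtain ⟨φ, hφ⟩ : ∃ φ : K →ₗ[ℚ] F, ∀ a, φ (algebraMap A K a) = ψ a := by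
    obtain ⟨g, hg⟩ := LinearMap.exists_leftInverse_of_injective
      (IsScalarTower.toAlgHom ℚ A K).toLinearMap
      (LinearMap.ker_eq_bot.2 (IsFractionRing.injective A K))
    exact ⟨ψ.toLinearMap ∘ₗ g, fun a => congrArg ψ (LinearMap.congr_fun hg a)⟩
  let N := Module.finrank ℚ V
  let τ : Ω → F := fun α => (N.factorial : F) * φ (Algebra.normalizedTrace K Ω α)
  have hnat : ∀ μ, ((pencil E (MvPolynomial.X : σ → A)).charpoly.map (ψ : A →+* F)).IsRoot μ →
      ∃ k : ℕ, μ = k := by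
    intro μ hμ
    rw [pencil_charpoly_map, ← Module.End.hasEigenvalue_iff_isRoot_charpoly] at hμ
    have hd : ψ ∘ MvPolynomial.X = d := funext fun i => MvPolynomial.aeval_X d i
    rw [hd] at hμ
    obtain ⟨x, hx⟩ := hμ.exists_hasEigenvector
    obtain ⟨k, -, hk⟩ := h.le_of_eigen hx.apply_eq_smul hx.2
    exact ⟨k, hk⟩
  have hnatZ : ∀ μ, ((pencil S (MvPolynomial.X : σ → A)).charpoly.map (ψ : A →+* F)).IsRoot μ →
      ∃ k : ℕ, 0 < k ∧ μ = k := by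
    intro μ hμ
    rw [pencil_charpoly_map, ← Module.End.hasEigenvalue_iff_isRoot_charpoly] at hμ
    have hd : ψ ∘ MvPolynomial.X = d := funext fun i => MvPolynomial.aeval_X d i
    rw [hd] at hμ
    obtain ⟨w, hw⟩ := hμ.exists_hasEigenvector
    have hinj : Function.Injective (Z.subtype.baseChange F) :=
      Module.Flat.lTensor_preserves_injective_linearMap (M := F) Z.subtype
        (Submodule.subtype_injective _)
    have heig : pencil E d (Z.subtype.baseChange F w) = μ • Z.subtype.baseChange F w := by
      rw [← pencil_intertwine hS, hw.apply_eq_smul, map_smul]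
    have h0 := aeval_int_apply_of_eigen heig (weightPoly m)
    rw [h.aeval_apply_eq_zero _ (baseChange_subtype_mem_center w)] at h0
    obtain ⟨k, hk, -, hμk⟩ := aeval_weightPoly_eq_zero_iff.1 ((smul_eq_zero.1 h0.symm).resolve_right
      fun h0 => hw.2 (hinj (by rw [h0, map_zero])))
    exact ⟨k, hk, hμk⟩
  have haeval : ∀ {W : Type _} [AddCommGroup W] [Module ℚ W] [FiniteDimensional ℚ W]
      (G : σ → Module.End ℚ W) {α : Ω},
      Module.End.HasEigenvalue ((pencil G t).baseChange Ω) α →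
        aeval α (pencil G (MvPolynomial.X : σ → A)).charpoly = 0 := by
    intro W _ _ _ G α hα
    have h1 := aeval_charpoly_of_hasEigenvalue_baseChange hα
    have h2 := pencil_charpoly_map G (MvPolynomial.X : σ → A) (IsScalarTower.toAlgHom ℚ A K)
    have h3 : pencil G t = pencil G (IsScalarTower.toAlgHom ℚ A K ∘ MvPolynomial.X) := rfl
    rw [h3, ← h2] at h1
    exact (aeval_map_algebraMap K α _).symm.trans h1
  have hdeg : ∀ {W : Type _} [AddCommGroup W] [Module ℚ W] [FiniteDimensional ℚ W]
      (G : σ → Module.End ℚ W),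
      (pencil G (MvPolynomial.X : σ → A)).charpoly.natDegree = Module.finrank ℚ W := by
    intro W _ _ _ G
    rw [LinearMap.charpoly_natDegree, Module.finrank_baseChange]
  have hτ : ∀ α, Module.End.HasEigenvalue ((pencil E t).baseChange Ω) α →
      ∃ k : ℕ, τ α = k := fun α hα =>
    (exists_factorial_mul_normalizedTrace_eq ψ φ hφ (LinearMap.charpoly_monic _) (haeval E hα)
      (hdeg E).le hnat).imp fun _ => And.left
  have hτZ : ∀ α, Module.End.HasEigenvalue ((pencil S t).baseChange Ω) α →
      ∃ k : ℕ, 0 < k ∧ τ α = k := fun α hα => by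
    obtain ⟨k, hk, hpos⟩ := exists_factorial_mul_normalizedTrace_eq ψ φ hφ
      (LinearMap.charpoly_monic _) (haeval S hα) ((hdeg S).le.trans (Submodule.finrank_le Z))
      fun μ hμ => (hnatZ μ hμ).imp fun _ => And.right
    refine ⟨k, hpos fun μ hμ => ?_, hk⟩
    obtain ⟨l, hl, rfl⟩ := hnatZ μ hμ
    exact_mod_cast hl.ne'
  have hex : ∀ α, ∃ k : ℕ, (∃ k : ℕ, τ α = k) → τ α = k := fun α => by
    by_cases hα : ∃ k : ℕ, τ α = k
    · exact hα.imp fun _ h _ => h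
    · exact ⟨0, fun h => absurd h hα⟩
  choose c hc using hex
  refine exists_isWeightDerivation_of_eigenvalues (Ω := Ω) (pencil E t) (· + ·)
    (fun α β x hx y hy =>
      lie_mem_maxGenEigenspace_add_s9 (leibniz_baseChange (leibniz_pencil hE t)) hx hy) c
    (fun α β hα hβ hαβ => ?_) (fun α β hα hβ hαβ => ?_) (pencil S t) _
    (pencil_intertwine hS t) fun α hα => ?_
  · have : τ α = τ β := by
      simp only [τ, Algebra.normalizedTrace_minpoly, hαβ]
    rw [hc α (hτ α hα), hc β (hτ β hβ)] at this
    exact_mod_cast this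
  · have : τ (α + β) = τ α + τ β := by
      simp only [τ, map_add, mul_add]
    rw [hc α (hτ α hα), hc β (hτ β hβ), hc _ (hτ _ hαβ)] at this
    exact_mod_cast this
  · obtain ⟨k, hk, hαk⟩ := hτZ α hα
    have := hc α ⟨k, hαk⟩
    rw [hαk] at this
    have : k = c α := by exact_mod_cast this
    lia

end GenericPencil

section Specialization

variable {V R K : Type*} [LieRing V] [LieAlgebra ℚ V] [CommRing R] [Algebra ℚ R]
  [Field K] [Algebra ℚ K]

theorem rTensor_lie (f : R →ₐ[ℚ] K) (u v : R ⊗[ℚ] V) :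
    f.toLinearMap.rTensor V ⁅u, v⁆ = ⁅f.toLinearMap.rTensor V u, f.toLinearMap.rTensor V v⁆ := by
  induction u using TensorProduct.induction_on with
  | zero => simp
  | tmul a x =>
    induction v using TensorProduct.induction_on with
    | zero => simp
    | tmul b y => simp [LieAlgebra.ExtendScalars.bracket_tmul]
    | add u v hu hv => simp only [lie_add, map_add, hu, hv]
  | add u v hu hv => simp only [add_lie, map_add, hu, hv]

theorem rTensor_smul (f : R →ₐ[ℚ] K) (r : R) (u : R ⊗[ℚ] V) :
    f.toLinearMap.rTensor V (r • u) = f r • f.toLinearMap.rTensor V u := by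
  induction u using TensorProduct.induction_on with
  | zero => simp
  | tmul a x => simp [TensorProduct.smul_tmul']
  | add u v hu hv => simp only [smul_add, map_add, hu, hv]

theorem tensorSlice_lie (ε : R →ₐ[ℚ] ℚ) (u v : R ⊗[ℚ] V) :
    tensorSlice ε.toLinearMap ⁅u, v⁆ =
      ⁅tensorSlice ε.toLinearMap u, tensorSlice ε.toLinearMap v⁆ := by
  rw [lie_tensorSlice_left]
  induction u using TensorProduct.induction_on with
  | zero => simp
  | tmul a x =>
    induction v using TensorProduct.induction_on with
    | zero => simp
    | tmul b y => simp [LieAlgebra.ExtendScalars.bracket_tmul, smul_smul, mul_comm]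
    | add u v hu hv => simp only [lie_add, map_add, TensorProduct.tmul_add, hu, hv]
  | add u v hu hv => simp only [add_lie, map_add, hu, hv]

/-- An operator with integral weights over `K` that is defined over a subring `R` can be
specialized along any rational point of `R`. -/
theorem exists_isWeightDerivation_of_specialization {D : Module.End K (K ⊗[ℚ] V)} {m : ℕ}
    {Z : Submodule ℚ V} (h : IsWeightDerivation D m (Set.range (Z.subtype.baseChange K)))
    (f : R →ₐ[ℚ] K) (hf : Function.Injective f) (ε : R →ₐ[ℚ] ℚ)
    (hD : ∀ x : V, ∃ w : R ⊗[ℚ] V, f.toLinearMap.rTensor V w = D (1 ⊗ₜ x)) :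
    ∃ D₀ : Module.End ℚ V, IsWeightDerivation D₀ m (Z : Set V) := by
  let j := f.toLinearMap.rTensor V
  have hj : Function.Injective j := Module.Flat.rTensor_preserves_injective_linearMap _ hf
  choose g hg using hD
  let g' : V →ₗ[ℚ] R ⊗[ℚ] V :=
    { toFun := g
      map_add' := fun x y => hj (by simp [j, hg, TensorProduct.tmul_add])
      map_smul' := fun r x => hj (by simp [j, hg]) }
  let DR : Module.End R (R ⊗[ℚ] V) := g'.liftBaseChange R
  have hDR : ∀ w, j (DR w) = D (j w) := by
    intro w
    induction w using TensorProduct.induction_on with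
    | zero => simp
    | tmul a x =>
      have : (f a ⊗ₜ[ℚ] x : K ⊗[ℚ] V) = f a • (1 : K) ⊗ₜ[ℚ] x := by
        simp [TensorProduct.smul_tmul']
      calc j (DR (a ⊗ₜ x)) = j (a • g x) := by simp [DR, g']
        _ = f a • D (1 ⊗ₜ x) := by rw [rTensor_smul, hg]
        _ = D (j (a ⊗ₜ x)) := by simp [j, this]
    | add u v hu hv => simp only [map_add, hu, hv]
  have hR : IsWeightDerivation DR m ((fun z : V => (1 : R) ⊗ₜ[ℚ] z) '' Z) := by
    refine h.of_injective j.toAddMonoidHom (rTensor_lie f) hj hDR ?_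
    rintro _ ⟨z, hz, rfl⟩
    exact ⟨1 ⊗ₜ ⟨z, hz⟩, by simp [j]⟩
  refine ⟨tensorSlice ε.toLinearMap ∘ₗ g', hR.of_surjective
    (tensorSlice ε.toLinearMap).toAddMonoidHom (tensorSlice_lie ε) (fun x => ⟨1 ⊗ₜ x, by simp⟩)
    (fun w => ?_) fun z hz => ⟨_, ⟨z, hz, rfl⟩, by simp⟩⟩
  change tensorSlice _ (DR w) = tensorSlice _ (g' (tensorSlice _ w))
  induction w using TensorProduct.induction_on with
  | zero => simp
  | tmul a x =>
    have : ∀ u : R ⊗[ℚ] V,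
        tensorSlice ε.toLinearMap (a • u) = ε a • tensorSlice ε.toLinearMap u := by
      intro u
      induction u using TensorProduct.induction_on with
      | zero => simp
      | tmul b y => simp [TensorProduct.smul_tmul', smul_smul]
      | add u v hu hv => simp only [smul_add, map_add, hu, hv]
    simp [DR, this]
  | add u v hu hv => simp only [map_add, hu, hv]

theorem exists_ne_zero_rTensor_eq_smul {A : Type*} [CommRing A] [IsDomain A] [Algebra ℚ A]
    [Algebra A K] [IsFractionRing A K] (f : A →ₐ[ℚ] K) (hf : ∀ a, f a = algebraMap A K a)
    (w : K ⊗[ℚ] V) :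
    ∃ a : A, a ≠ 0 ∧ ∃ u : A ⊗[ℚ] V, f.toLinearMap.rTensor V u = f a • w := by
  induction w using TensorProduct.induction_on with
  | zero => exact ⟨1, one_ne_zero, 0, by simp⟩
  | tmul c x =>
    obtain ⟨a, b, hb, rfl⟩ := IsFractionRing.div_surjective (A := A) c
    have hb' : algebraMap A K b ≠ 0 := IsFractionRing.to_map_ne_zero_of_mem_nonZeroDivisors hb
    refine ⟨b, nonZeroDivisors.ne_zero hb, a ⊗ₜ x, ?_⟩
    rw [LinearMap.rTensor_tmul, AlgHom.toLinearMap_apply, hf, hf, TensorProduct.smul_tmul',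
      smul_eq_mul, mul_div_cancel₀ _ hb']
  | add w w' hw hw' =>
    obtain ⟨a, ha, u, hu⟩ := hw
    obtain ⟨a', ha', u', hu'⟩ := hw'
    refine ⟨a * a', mul_ne_zero ha ha', a' • u + a • u', ?_⟩
    rw [map_add, rTensor_smul, rTensor_smul, hu, hu', smul_smul, smul_smul, map_mul, smul_add,
      mul_comm (f a')]

theorem exists_isWeightDerivation_of_fractionRing [FiniteDimensional ℚ V] {σ : Type*}
    [Algebra (MvPolynomial σ ℚ) K] [IsFractionRing (MvPolynomial σ ℚ) K]
    [IsScalarTower ℚ (MvPolynomial σ ℚ) K] {D : Module.End K (K ⊗[ℚ] V)} {m : ℕ}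
    {Z : Submodule ℚ V} (h : IsWeightDerivation D m (Set.range (Z.subtype.baseChange K))) :
    ∃ D₀ : Module.End ℚ V, IsWeightDerivation D₀ m (Z : Set V) := by
  let A := MvPolynomial σ ℚ
  let f : A →ₐ[ℚ] K := IsScalarTower.toAlgHom ℚ A K
  let b := Module.finBasis ℚ V
  choose a ha u hu using fun i =>
    exists_ne_zero_rTensor_eq_smul f (fun _ => rfl) (D (1 ⊗ₜ b i))
  obtain ⟨q, hq⟩ : ∃ q : σ → ℚ, MvPolynomial.eval q (∏ i, a i) ≠ 0 := by
    by_contra! hq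
    exact Finset.prod_ne_zero_iff.2 (fun i _ => ha i) (MvPolynomial.funext (by simpa using hq))
  rw [map_prod, Finset.prod_ne_zero_iff] at hq
  let S : Submonoid A := (nonZeroDivisors ℚ).comap (MvPolynomial.eval q)
  have hS : S ≤ nonZeroDivisors A := fun s hs => mem_nonZeroDivisors_of_ne_zero fun h0 =>
    nonZeroDivisors.ne_zero (Submonoid.mem_comap.1 hs) (by rw [h0, map_zero])
  let R := Localization.subalgebra.ofField K S hS
  let ε : R →ₐ[ℚ] ℚ := RingHom.toRatAlgHom <|
    IsLocalization.lift (M := S) (g := MvPolynomial.eval q) fun s =>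
      isUnit_iff_ne_zero.2 (nonZeroDivisors.ne_zero s.2)
  refine exists_isWeightDerivation_of_specialization h (R.val.restrictScalars ℚ)
    Subtype.val_injective ε fun x => ?_
  change D (1 ⊗ₜ x) ∈ LinearMap.range ((R.val.restrictScalars ℚ).toLinearMap.rTensor V)
  have hx : x ∈ Submodule.span ℚ (Set.range b) := b.span_eq ▸ Submodule.mem_top
  induction hx using Submodule.span_induction with
  | zero => simp
  | add x y _ _ hx hy => rw [TensorProduct.tmul_add, map_add]; exact add_mem hx hy
  | smul r x _ hx =>
    rw [TensorProduct.tmul_smul, map_rat_smul]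
    exact Submodule.smul_mem _ r hx
  | mem x hx =>
    obtain ⟨i, rfl⟩ := hx
    have hi : a i ∈ S := mem_nonZeroDivisors_of_ne_zero (hq i (Finset.mem_univ i))
    obtain ⟨c, hc⟩ := IsLocalization.map_units R (⟨a i, hi⟩ : S)
    let r : A →ₐ[ℚ] R := IsScalarTower.toAlgHom ℚ A R
    refine ⟨(↑c⁻¹ : R) • r.toLinearMap.rTensor V (u i), ?_⟩
    have hr : (R.val.restrictScalars ℚ).toLinearMap.rTensor V (r.toLinearMap.rTensor V (u i)) =
        f (a i) • D (1 ⊗ₜ b i) := by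
      rw [← hu, ← LinearMap.comp_apply, ← LinearMap.rTensor_comp]
      rfl
    have hfc : f (a i) = R.val c := congrArg R.val hc.symm
    rw [rTensor_smul, hr, smul_smul, hfc]
    change (R.val ↑c⁻¹ * R.val ↑c) • _ = _
    rw [← map_mul, Units.inv_mul, map_one, one_smul]

end Specialization

/-- For a finite-dimensional Lie algebra `𝔫` over `ℚ` with center `𝔷`,
the following are equivalent: (i) `𝔫` admits a non-negative special grading over `ℚ`;
(ii) `ℂ ⊗ 𝔫` admits a non-negative special grading; (iii) there is a Lie algebra
automorphism `f` of `𝔫` such that no eigenvalue of the restriction of `f` to `𝔷` is an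
algebraic integer, while every eigenvalue of `f⁻¹` is an algebraic integer. -/
theorem hasNonnegSpecialGrading_tfae
    {𝔫 : Type*} [LieRing 𝔫] [LieAlgebra ℚ 𝔫] [FiniteDimensional ℚ 𝔫] :
    (HasNonnegSpecialGrading ℚ 𝔫 ↔ HasNonnegSpecialGrading ℂ (ℂ ⊗[ℚ] 𝔫)) ∧
    (HasNonnegSpecialGrading ℂ (ℂ ⊗[ℚ] 𝔫) ↔
      ∃ f : 𝔫 ≃ₗ⁅ℚ⁆ 𝔫,
        (∀ μ : AlgebraicClosure ℚ,
          (∃ x ∈ Submodule.baseChange (AlgebraicClosure ℚ)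
                (LieAlgebra.center ℚ 𝔫).toSubmodule,
            x ≠ 0 ∧
              LinearMap.baseChange (AlgebraicClosure ℚ) f.toLieHom.toLinearMap x = μ • x) →
          ¬ IsIntegral ℤ μ) ∧
        (∀ μ : AlgebraicClosure ℚ,
          Module.End.HasEigenvalue
            (LinearMap.baseChange (AlgebraicClosure ℚ) f.symm.toLieHom.toLinearMap) μ →
          IsIntegral ℤ μ)) := by
  have hdescend : HasNonnegSpecialGrading ℂ (ℂ ⊗[ℚ] 𝔫) → HasNonnegSpecialGrading ℚ 𝔫 := by
    intro h
    obtain ⟨D, m, hD⟩ := h.exists_isWeightDerivation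
    obtain ⟨n, E, d, hE, rfl⟩ := exists_eq_pencil hD.leibniz
    obtain ⟨D', m', hD'⟩ := exists_isWeightDerivation_fractionRing hE hD
      (FractionRing (MvPolynomial (Fin n) ℚ))
    obtain ⟨D₀, hD₀⟩ := exists_isWeightDerivation_of_fractionRing (σ := Fin n) hD'
    exact IsWeightDerivation.hasNonnegSpecialGrading hD₀
  have hextend : HasNonnegSpecialGrading ℚ 𝔫 → HasNonnegSpecialGrading ℂ (ℂ ⊗[ℚ] 𝔫) := by
    intro h
    obtain ⟨D, m, hD⟩ := h.exists_isWeightDerivation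
    exact hD.baseChange.hasNonnegSpecialGrading
  refine ⟨⟨hextend, hdescend⟩, fun h => ?_, ?_⟩
  · obtain ⟨D, m, hD⟩ := (hdescend h).exists_isWeightDerivation
    refine ⟨hD.scalingEquiv (r := 2⁻¹) (s := 2) (by norm_num), ?_, fun μ hμ => ?_⟩
    · rintro μ ⟨x, hxZ, hx0, hx⟩
      exact IsWeightDerivation.not_isIntegral_of_mem_baseChange
        (Z := (LieAlgebra.center ℚ 𝔫).toSubmodule) hD hxZ hx0 hx
    · exact hD.isIntegral_of_hasEigenvalue hμ
  · rintro ⟨f, hcenter, hsymm⟩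
    obtain ⟨D, m, hD⟩ := exists_isWeightDerivation_of_lieEquiv f hcenter hsymm
    exact hextend hD.hasNonnegSpecialGrading
end
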